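/- arXiv:1201.4549 — 2 statements merged into one kernel-verified Lean document; each statement's English description precedes it below -/
import Mathlib

section
/- Let K=K(c_1,c_2,c_1) be a symmetric A_3-crystal with symmetric extract B, and let v be a self-complementary vertex. Then: (i) if the worm operator 1tilde does not act at w(v), then the operator F_{1bar} does not act at v in B; (ii) if 1tilde acts at w(v), then F_{1bar} acts at v and w(F_{1bar}(v))=1tilde(w(v)). -/
open Classical

noncomputable section

/-- Iterate a partial operator `k` times. -/
def optIter {V : Type} (f : V → Option V) : ℕ → V → Option V
  | 0, v => some v
  | k + 1, v => (f v).bind (optIter f k)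

/-- A vertex type together with, for every natural number (color) `i`,
a partial operator whose graph is the set of `i`-edges. -/
structure PreGraph where
  V : Type
  F : ℕ → V → Option V

namespace PreGraph

/-- Partial inverse operator of color `i`. -/
def Finv (K : PreGraph) (i : ℕ) (v : K.V) : Option K.V :=
  if h : ∃ u, K.F i u = some v then some h.choose else none

/-- Number of edges of the maximal `i`-colored path beginning at `v`. -/
def h (K : PreGraph) (i : ℕ) (v : K.V) : ℕ :=
  sSup {k | (optIter (K.F i) k v).isSome = true}

/-- Number of edges of the maximal `i`-colored path ending at `v`. -/
def t (K : PreGraph) (i : ℕ) (v : K.V) : ℕ :=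
  sSup {k | ∃ u, optIter (K.F i) k u = some v}

/-- One (undirected) step along an edge of any color. -/
def Step (K : PreGraph) (u v : K.V) : Prop :=
  ∃ i, K.F i u = some v ∨ K.F i v = some u

/-- Weak connectivity. -/
def Connected (K : PreGraph) : Prop :=
  ∀ u v : K.V, Relation.ReflTransGen K.Step u v

/-- All edges have colors in `C`. -/
def ColorsIn (K : PreGraph) (C : Set ℕ) : Prop :=
  ∀ i ∉ C, ∀ v, K.F i v = none

end PreGraph

/-- `s` has no incoming edges. -/
def IsSource (K : PreGraph) (s : K.V) : Prop := ∀ i u, K.F i u ≠ some s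

/-- `tv` has no outgoing edges. -/
def IsSink (K : PreGraph) (tv : K.V) : Prop := ∀ i, K.F i tv = none

/-- `K` is a (finite) colored graph with colors in `C` satisfying axiom (A1):
every connected monochromatic subgraph is a finite directed path. -/
def IsColored (K : PreGraph) (C : Set ℕ) : Prop :=
  Finite K.V ∧ K.ColorsIn C ∧
  (∀ (i : ℕ) (u u' v : K.V), K.F i u = some v → K.F i u' = some v → u = u') ∧
  (∀ (i : ℕ) (v : K.V) (k : ℕ), 0 < k → optIter (K.F i) k v ≠ some v)

/-- `|i - j| = 1`. -/
def Neighb (i j : ℕ) : Prop := i + 1 = j ∨ j + 1 = i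

/-- `|i - j| ≥ 2`. -/
def Far (i j : ℕ) : Prop := i + 2 ≤ j ∨ j + 2 ≤ i

instance (i j : ℕ) : Decidable (Neighb i j) := by unfold Neighb; infer_instance
instance (i j : ℕ) : Decidable (Far i j) := by unfold Far; infer_instance

/-- Axiom (A2) for the ordered pair of distinct colors `(i, j)`. -/
def A2at (K : PreGraph) (i j : ℕ) : Prop :=
  (∀ u v, K.F i u = some v →
    K.t j v ≤ K.t j u ∧ K.h j u ≤ K.h j v ∧
    ((K.h j u : ℤ) - (K.t j u : ℤ)) - ((K.h j v : ℤ) - (K.t j v : ℤ)) =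
      (if Neighb i j then (-1 : ℤ) else 0)) ∧
  (∀ u v w, K.F i u = some v → K.F i v = some w →
    2 * K.h j v ≤ K.h j u + K.h j w)

/-- Axiom (A3) for neighboring colors `i, j`. -/
def A3at (K : PreGraph) (i j : ℕ) : Prop :=
  (∀ u v v', K.F i u = some v → K.F j u = some v' →
    K.h j v = K.h j u →
    ((K.h i v' : ℤ) - (K.h i u : ℤ) = 1 ∧ ∃ w, K.F j v = some w ∧ K.F i v' = some w)) ∧
  (∀ u u' v, K.F i u = some v → K.F j u' = some v →
    (K.h j v : ℤ) - (K.h j u : ℤ) = 1 →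
    (K.h i v = K.h i u' ∧ ∃ w, K.F j w = some u ∧ K.F i w = some u'))

/-- Axiom (A4) (Verma relations) for neighboring colors `i, j`. -/
def A4at (K : PreGraph) (i j : ℕ) : Prop :=
  (∀ u v v', K.F i u = some v → K.F j u = some v' →
    (K.h j v : ℤ) - (K.h j u : ℤ) = 1 → (K.h i v' : ℤ) - (K.h i u : ℤ) = 1 →
    ∃ w, (((K.F i u).bind (K.F j)).bind (K.F j)).bind (K.F i) = some w ∧
         (((K.F j u).bind (K.F i)).bind (K.F i)).bind (K.F j) = some w) ∧
  (∀ u u' v, K.F i u = some v → K.F j u' = some v →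
    K.h j v = K.h j u → K.h i v = K.h i u' →
    ∃ w, (((K.Finv i v).bind (K.Finv j)).bind (K.Finv j)).bind (K.Finv i) = some w ∧
         (((K.Finv j v).bind (K.Finv i)).bind (K.Finv i)).bind (K.Finv j) = some w)

/-- Axiom (A5) for colors `i, j` at distance at least 2. -/
def A5at (K : PreGraph) (i j : ℕ) : Prop :=
  ∀ Fi ∈ ({K.F i, K.Finv i} : Set (K.V → Option K.V)),
  ∀ Fj ∈ ({K.F j, K.Finv j} : Set (K.V → Option K.V)),
  ∀ v, (Fi v).isSome → (Fj v).isSome →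
    ∃ w, (Fi v).bind Fj = some w ∧ (Fj v).bind Fi = some w

/-- `K` is a regular crystal of type A on the color set `C`
(an `A_{|C|}`-crystal when `C` is an integer interval). -/
def IsCrystalOn (K : PreGraph) (C : Set ℕ) : Prop :=
  IsColored K C ∧ K.Connected ∧
  (∀ i ∈ C, ∀ j ∈ C, i ≠ j → A2at K i j) ∧
  (∀ i ∈ C, ∀ j ∈ C, Neighb i j → A3at K i j ∧ A4at K i j) ∧
  (∀ i ∈ C, ∀ j ∈ C, Far i j → A5at K i j)

/-- `K` is an `A_n`-crystal (colors `1, …, n`). -/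
def IsACrystal (n : ℕ) (K : PreGraph) : Prop := IsCrystalOn K (Set.Icc 1 n)

/-- Apply a list of operators, head first. -/
def applyStr (K : PreGraph) : List ℕ → K.V → Option K.V
  | [], v => some v
  | i :: L, v => (K.F i v).bind (applyStr K L)

/-- The string `w_{m,k,j} = F_{o+j} F_{o+j+1} ⋯ F_{o+j+k-1}` (rightmost applied
first, i.e. head of the list applied first) for a crystal with colors `o+1, …, o+m`. -/
def wStr (o k j : ℕ) : List ℕ := (List.range k).map (fun m => o + j + k - 1 - m)

/-- The string `S_{m,k} = w_{m,k,m-k+1} ⋯ w_{m,k,2} w_{m,k,1}` for a crystal with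
colors `o+1, …, o+m`. -/
def SStr (o m k : ℕ) : List ℕ :=
  (List.range (m - k + 1)).flatMap fun jm => wStr o k (jm + 1)

/-- The string `S_{m,m}^{a_{o+m}} ⋯ S_{m,1}^{a_{o+1}}` for a crystal with colors
`o+1, …, o+m`, defining the principal vertex with coordinates `a`. -/
def prinStr (o m : ℕ) (a : ℕ → ℕ) : List ℕ :=
  (List.range m).flatMap fun km => (List.replicate (a (o + km + 1)) (SStr o m (km + 1))).flatten

def prinOpt (K : PreGraph) (o m : ℕ) (s : K.V) (a : ℕ → ℕ) : Option K.V :=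
  applyStr K (prinStr o m a) s

/-- `p` is the principal vertex with coordinates `a` of the crystal `K` with colors
`o+1, …, o+m` and source `s`. -/
def IsPrin (K : PreGraph) (o m : ℕ) (s : K.V) (a : ℕ → ℕ) (p : K.V) : Prop :=
  prinOpt K o m s a = some p

/-- The principal lattice of an `A_n`-crystal with source `s` and parameter `c`. -/
def PrinLat (K : PreGraph) (n : ℕ) (s : K.V) (c : ℕ → ℕ) : Set K.V :=
  {p | ∃ a : ℕ → ℕ, (∀ i, 1 ≤ i → i ≤ n → a i ≤ c i) ∧ IsPrin K 0 n s a p}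

/-- One undirected step along an edge with color in `I`. -/
def stepOn (K : PreGraph) (I : Set ℕ) (u v : K.V) : Prop :=
  ∃ i ∈ I, K.F i u = some v ∨ K.F i v = some u

/-- `u` lies in the same `I`-colored component as `v`. -/
def inComp (K : PreGraph) (I : Set ℕ) (v u : K.V) : Prop :=
  Relation.ReflTransGen (stepOn K I) v u

/-- The subcrystal of `K` with color set `I` containing `v` (the maximal connected
subgraph through `v` using only colors in `I`). -/
def PreGraph.sub (K : PreGraph) (I : Set ℕ) (v : K.V) : PreGraph where
  V := {u : K.V // inComp K I v u}
  F := fun i u =>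
    if hi : i ∈ I then
      (K.F i u.1).pbind fun w hw =>
        some ⟨w, Relation.ReflTransGen.tail u.2 ⟨i, hi, Or.inl (Option.mem_def.mp hw)⟩⟩
    else none

/-- Directed reachability. -/
def dirReach (K : PreGraph) (u v : K.V) : Prop :=
  Relation.ReflTransGen (fun a b => ∃ i, K.F i a = some b) u v

/-- The interval of `K` from `p` to `q`: the subgraph formed by all vertices and
edges lying on directed paths from `p` to `q`. -/
def PreGraph.interval (K : PreGraph) (p q : K.V) : PreGraph where
  V := {w : K.V // dirReach K p w ∧ dirReach K w q}
  F := fun i u =>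
    (K.F i u.1).pbind fun w _ =>
      if hw : dirReach K p w ∧ dirReach K w q then some ⟨w, hw⟩ else none

/-- The symmetric extract: restriction to self-complementary vertices,
with `ibar`-edges given by `chain i`. -/
def extract (K : PreGraph) (chain : ℕ → K.V → Option K.V) (σ : K.V → K.V) : PreGraph where
  V := {v : K.V // σ v = v}
  F := fun i u =>
    (chain i u.1).pbind fun w _ => if hw : σ w = w then some ⟨w, hw⟩ else none

/-- The operator chain for the color `ibar` of the symmetric extract of a
symmetric `A_{2n-1}`-crystal. -/
def chainB (K : PreGraph) (n : ℕ) (i : ℕ) (u : K.V) : Option K.V :=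
  if 1 ≤ i ∧ i ≤ n then
    (if i = n then K.F n u else (K.F i u).bind (K.F (2 * n - i)))
  else none

/-- The operator chain for the color `ibar` of the symmetric extract of a
symmetric `A_{2n}`-crystal. -/
def chainC (K : PreGraph) (n : ℕ) (i : ℕ) (u : K.V) : Option K.V :=
  if 1 ≤ i ∧ i ≤ n then
    (if i = n then (((K.F n u).bind (K.F (n + 1))).bind (K.F (n + 1))).bind (K.F n)
     else (K.F i u).bind (K.F (2 * n + 1 - i)))
  else none

/-- Symmetric extract from a symmetric `A_{2n-1}`-crystal. -/
def extractB (K : PreGraph) (n : ℕ) (σ : K.V → K.V) : PreGraph := extract K (chainB K n) σ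

/-- Symmetric extract from a symmetric `A_{2n}`-crystal. -/
def extractC (K : PreGraph) (n : ℕ) (σ : K.V → K.V) : PreGraph := extract K (chainC K n) σ

/-- Admissibility of a six-tuple `(x', y, x''; y', x, y'')` in the worm model. -/
def WormOK (g1 g2 : ℕ) : ℤ × ℤ × ℤ × ℤ × ℤ × ℤ → Prop
  | (x', y, x'', y', x, y'') =>
    (0 ≤ x' ∧ x' ≤ 2 * (g1 : ℤ)) ∧ (0 ≤ x'' ∧ x'' ≤ 2 * (g1 : ℤ)) ∧
    (0 ≤ x ∧ x ≤ 2 * (g1 : ℤ)) ∧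
    (0 ≤ y' ∧ y' ≤ (g2 : ℤ)) ∧ (0 ≤ y'' ∧ y'' ≤ (g2 : ℤ)) ∧ (0 ≤ y ∧ y ≤ (g2 : ℤ)) ∧
    (2 ∣ x') ∧ (2 ∣ x'') ∧ (y' ≤ y ∧ y ≤ y'') ∧ (x' ≤ x ∧ x ≤ x'') ∧
    (y' < y → x' = x) ∧ (y < y'' → x = x'')

/-- The candidate image of a worm under the operator `1tilde`. -/
def worm1 : ℤ × ℤ × ℤ × ℤ × ℤ × ℤ → ℤ × ℤ × ℤ × ℤ × ℤ × ℤ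
  | (x', y, x'', y', x, y'') =>
    if 2 * x > x' + x'' then (x' + 2, y, x'', y', x, y'')
    else if x = x' ∧ x' = x'' ∧ y < y'' then (x', y + 1, x'', y', x, y'')
    else (x', y, x'' + 2, y', x, y'')

/-- The candidate image of a worm under the operator `2tilde`. -/
def worm2 : ℤ × ℤ × ℤ × ℤ × ℤ × ℤ → ℤ × ℤ × ℤ × ℤ × ℤ × ℤ
  | (x', y, x'', y', x, y'') =>
    if 2 * y > y' + y'' then (x', y, x'', y' + 1, x, y'')
    else if y' = y ∧ y = y'' ∧ x < x'' then (x', y, x'', y', x + 1, y'')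
    else (x', y, x'', y', x, y'' + 1)

/-- The worm graph `W(g1, g2)`, with colors `1 = 1tilde` and `2 = 2tilde`. -/
def WormGraph (g1 g2 : ℕ) : PreGraph where
  V := {w : ℤ × ℤ × ℤ × ℤ × ℤ × ℤ // WormOK g1 g2 w}
  F := fun i u =>
    if i = 1 then
      (if h1 : WormOK g1 g2 (worm1 u.1) then some ⟨worm1 u.1, h1⟩ else none)
    else if i = 2 then
      (if h2 : WormOK g1 g2 (worm2 u.1) then some ⟨worm2 u.1, h2⟩ else none)
    else none

/-- Isomorphism of colored graphs, renaming colors via `φ`. -/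
def IsoVia (K L : PreGraph) (φ : ℕ → ℕ) : Prop :=
  ∃ e : K.V ≃ L.V, ∀ i u v, K.F i u = some v ↔ L.F (φ i) (e u) = some (e v)

/-- The Cartesian product of an `i`-path of length `p` and a `j`-path of length `q`. -/
def boxGraph (i j p q : ℕ) : PreGraph where
  V := Fin (p + 1) × Fin (q + 1)
  F := fun s u =>
    if s = i then
      (if h : (u.1 : ℕ) < p then some (⟨(u.1 : ℕ) + 1, by omega⟩, u.2) else none)
    else if s = j then
      (if h : (u.2 : ℕ) < q then some (u.1, ⟨(u.2 : ℕ) + 1, by omega⟩) else none)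
    else none

/-- `B_n`-crystal: components with colors `n-1, n` are worm graphs,
with color `n-1` corresponding to `1tilde` and `n` to `2tilde`. -/
def IsBCrystal (n : ℕ) (B : PreGraph) : Prop :=
  IsColored B (Set.Icc 1 n) ∧ B.Connected ∧
  (∀ i ∈ Set.Icc 1 n, ∀ j ∈ Set.Icc 1 n, Far i j → A5at B i j) ∧
  (∀ i j, 1 ≤ i → i < n → 1 ≤ j → j < n → Neighb i j →
    ∀ v : B.V, IsCrystalOn (B.sub {i, j} v) {i, j}) ∧
  (∀ v : B.V, ∃ g1 g2 : ℕ,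
    IsoVia (B.sub ({n - 1, n} : Set ℕ) v) (WormGraph g1 g2)
      (fun x => if x = n - 1 then 1 else if x = n then 2 else 0))

/-- `C_n`-crystal: components with colors `n-1, n` are worm graphs,
with color `n-1` corresponding to `2tilde` and `n` to `1tilde`. -/
def IsCCrystal (n : ℕ) (B : PreGraph) : Prop :=
  IsColored B (Set.Icc 1 n) ∧ B.Connected ∧
  (∀ i ∈ Set.Icc 1 n, ∀ j ∈ Set.Icc 1 n, Far i j → A5at B i j) ∧
  (∀ i j, 1 ≤ i → i < n → 1 ≤ j → j < n → Neighb i j →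
    ∀ v : B.V, IsCrystalOn (B.sub {i, j} v) {i, j}) ∧
  (∀ v : B.V, ∃ g1 g2 : ℕ,
    IsoVia (B.sub ({n - 1, n} : Set ℕ) v) (WormGraph g1 g2)
      (fun x => if x = n - 1 then 2 else if x = n then 1 else 0))

/-! ### The crossing model -/

/-- `(k, i, j)` is a node `v_i^k(j)` of the supporting graph `G` for rank `n`. -/
def isNode (n k i j : ℕ) : Prop :=
  1 ≤ j ∧ j ≤ i ∧ i ≤ n ∧ i - j + 1 ≤ k ∧ k ≤ n - j + 1

instance (n k i j : ℕ) : Decidable (isNode n k i j) := by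
  unfold isNode; infer_instance

/-- Extension of a function on the nodes of `G` to the extended supporting graph:
extra nodes from which `G^k` is reachable get value `c k`, the others get `0`. -/
def fext (n : ℕ) (c : ℕ → ℕ) (f : ℕ × ℕ × ℕ → ℤ) (k i j : ℕ) : ℤ :=
  if isNode n k i j then f (k, i, j)
  else if j ≤ n - k + 1 then (c k : ℤ) else 0

/-- The slack at the node `v_i^k(j)`. -/
def epsN (n : ℕ) (c : ℕ → ℕ) (f : ℕ × ℕ × ℕ → ℤ) (k i j : ℕ) : ℤ :=
  (fext n c f k (i - 1) (j - 1) - fext n c f k i j) -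
    (fext n c f k i (j - 1) - fext n c f k (i + 1) j)

/-- The total slack at the multinode `V_i(j)`. -/
def epsTot (n : ℕ) (c : ℕ → ℕ) (f : ℕ × ℕ × ℕ → ℤ) (i j : ℕ) : ℤ :=
  ∑ k ∈ Finset.Icc (i - j + 1) (n - j + 1), epsN n c f k i j

/-- The reduced slack at the multinode `V_i(j)`. -/
def teps (n : ℕ) (c : ℕ → ℕ) (f : ℕ × ℕ × ℕ → ℤ) (i j : ℕ) : ℤ :=
  if hj : (Finset.Icc 1 j).Nonempty then
    max 0 ((Finset.Icc 1 j).inf' hj fun p => ∑ q ∈ Finset.Icc p j, epsTot n c f i q)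
  else 0

/-- `k0` satisfies the switch condition in the multinode `V_i(j)`. -/
def switchCond (n : ℕ) (f : ℕ × ℕ × ℕ → ℤ) (i j k0 : ℕ) : Prop :=
  i - j + 1 ≤ k0 ∧ k0 ≤ n - j + 1 ∧
  (∀ k, i - j + 1 ≤ k → k < k0 → isNode n k (i + 1) (j + 1) →
    f (k, i, j) = f (k, i + 1, j + 1)) ∧
  (∀ k, k0 < k → k ≤ n - j + 1 → isNode n k (i + 1) j →
    f (k, i + 1, j) = f (k, i, j))

/-- The switch-node (first node with the switch property) of the multinode `V_i(j)`. -/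
def switchNode (n : ℕ) (f : ℕ × ℕ × ℕ → ℤ) (i j : ℕ) : ℕ :=
  sInf {k0 | switchCond n f i j k0}

/-- Feasible functions of the crossing model (normalized to vanish off the nodes). -/
def Feasible (n : ℕ) (c : ℕ → ℕ) (f : ℕ × ℕ × ℕ → ℤ) : Prop :=
  (∀ k i j, ¬ isNode n k i j → f (k, i, j) = 0) ∧
  (∀ k i j, isNode n k i j → isNode n k (i - 1) j → f (k, i - 1, j) ≤ f (k, i, j)) ∧
  (∀ k i j, isNode n k i j → isNode n k (i + 1) (j + 1) → f (k, i + 1, j + 1) ≤ f (k, i, j)) ∧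
  (∀ k i j, isNode n k i j → 0 ≤ f (k, i, j) ∧ f (k, i, j) ≤ (c k : ℤ)) ∧
  (∀ i j, 1 ≤ j → j ≤ i → i ≤ n → ∃ k0, switchCond n f i j k0)

/-- Increase `f` by one at the node `(k, i, j)`. -/
def bump (f : ℕ × ℕ × ℕ → ℤ) (k i j : ℕ) : ℕ × ℕ × ℕ → ℤ :=
  fun x => if x = (k, i, j) then f x + 1 else f x

/-- The crossing-model graph `Kscr(c)`: vertices are the feasible functions, and
the move `φ_i` increases `f` by one at the switch-node of the active multinode. -/
def Kscr (n : ℕ) (c : ℕ → ℕ) : PreGraph where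
  V := {f : ℕ × ℕ × ℕ → ℤ // Feasible n c f}
  F := fun i f =>
    if 1 ≤ i ∧ i ≤ n ∧ ∃ j, 1 ≤ j ∧ j ≤ i ∧ 0 < teps n c f.1 i j then
      (let j := sSup {j | 1 ≤ j ∧ j ≤ i ∧ 0 < teps n c f.1 i j}
       let g := bump f.1 (switchNode n f.1 i j) i j
       if hg : Feasible n c g then some ⟨g, hg⟩ else none)
    else none

/-- The function `f_{a,D}` of the crossing model. -/
def faD (n : ℕ) (a : ℕ → ℕ) (D : ℕ → ℤ) : ℕ × ℕ × ℕ → ℤ := fun x =>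
  if isNode n x.1 x.2.1 x.2.2 then
    (if x.2.1 - x.2.2 + 1 = x.1 then (a x.1 : ℤ) else (a x.1 : ℤ) + min (D (x.1 - 1)) 0) +
    (if x.2.2 ≤ n - x.1 then max (D x.1) 0 else 0)
  else 0

/-! ### Descriptions of self-complementary vertices -/

/-- `(a1, a2, δ, l)` is the description of a self-complementary vertex `v` of a
symmetric `A_3`-crystal `K` with source `s` and parameter `c`. -/
def IsDescB (K : PreGraph) (s : K.V) (c : ℕ → ℕ) (v : K.V) (q : ℕ × ℕ × ℤ × ℕ) : Prop :=
  q.2.2.2 = K.t 2 v ∧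
  ∃ (a : ℕ → ℕ) (pa : K.V),
    a 1 = q.1 ∧ a 2 = q.2.1 ∧ a 3 = ((q.1 : ℤ) + max q.2.2.1 0).toNat ∧
    (∀ i, 1 ≤ i → i ≤ 3 → a i ≤ c i) ∧
    IsPrin K 0 3 s a pa ∧ inComp K (Set.Icc 1 2) pa v ∧
    0 ≤ (q.2.1 : ℤ) + q.2.2.1 ∧ 0 ≤ (a 3 : ℤ) - q.2.2.1 ∧
    ∃ s' : (K.sub (Set.Icc 1 2) pa).V, IsSource (K.sub (Set.Icc 1 2) pa) s' ∧
    ∃ z : (K.sub (Set.Icc 1 2) pa).V,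
      IsPrin (K.sub (Set.Icc 1 2) pa) 0 2 s'
        (fun i => if i = 1 then ((q.2.1 : ℤ) + q.2.2.1).toNat else ((a 3 : ℤ) - q.2.2.1).toNat) z ∧
      inComp K ({2} : Set ℕ) z.1 v

/-- The polytope of descriptions for a symmetric `A_3`-crystal with parameter `(c1, c2, c1)`. -/
def QuadB (c1 c2 : ℕ) : Set (ℕ × ℕ × ℤ × ℕ) :=
  {q | q.1 ≤ c1 ∧ q.2.1 ≤ c2 ∧ -(q.2.1 : ℤ) ≤ q.2.2.1 ∧ (q.2.1 : ℤ) - (c2 : ℤ) ≤ q.2.2.1 ∧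
       q.2.2.1 ≤ (c1 : ℤ) - (q.1 : ℤ) ∧ (q.2.2.2 : ℤ) ≤ (c2 : ℤ) + 2 * q.2.2.1}

/-- The worm associated to the description `(a1, a2, δ, l)`. -/
def wtupleB (a1 a2 : ℕ) (δ : ℤ) (l : ℕ) : ℤ × ℤ × ℤ × ℤ × ℤ × ℤ :=
  let a3 : ℤ := (a1 : ℤ) + max δ 0
  let tr : ℤ × ℤ × ℤ :=
    if 0 ≤ δ then
      if (l : ℤ) ≤ (a2 : ℤ) then ((l : ℤ), 2 * (a1 : ℤ), (a2 : ℤ))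
      else if (l : ℤ) ≤ (a2 : ℤ) + 2 * δ then
        ((a2 : ℤ), 2 * (a1 : ℤ) + (l : ℤ) - (a2 : ℤ), (a2 : ℤ))
      else ((a2 : ℤ), 2 * a3, (l : ℤ) - 2 * δ)
    else
      if (l : ℤ) ≤ (a2 : ℤ) + δ then ((l : ℤ), 2 * (a1 : ℤ), (a2 : ℤ) - δ)
      else ((a2 : ℤ) + δ, 2 * (a1 : ℤ), (l : ℤ) - 2 * δ)
  (2 * (a1 : ℤ), (a2 : ℤ), 2 * a3, tr.1, tr.2.1, tr.2.2)

def wtQ (q : ℕ × ℕ × ℤ × ℕ) : ℤ × ℤ × ℤ × ℤ × ℤ × ℤ :=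
  wtupleB q.1 q.2.1 q.2.2.1 q.2.2.2

/-- The string `(F_2 F_3)^r (F_3 F_2)^r` (rightmost applied first). -/
def diagStr (r : ℕ) : List ℕ :=
  (List.replicate r ([2, 3] : List ℕ)).flatten ++ (List.replicate r ([3, 2] : List ℕ)).flatten

/-- `(a1, a2, δ, ρ)` is the description of a self-complementary vertex `v` of a
symmetric `A_4`-crystal `K` with source `s` and parameter `c`. -/
def IsDescC (K : PreGraph) (s : K.V) (c : ℕ → ℕ) (v : K.V) (q : ℕ × ℕ × ℤ × ℕ) : Prop :=
  ∃ (a : ℕ → ℕ) (pa : K.V),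
    a 1 = q.1 ∧ a 2 = q.2.1 ∧ a 3 = ((q.2.1 : ℤ) + min q.2.2.1 0).toNat ∧
    a 4 = ((q.1 : ℤ) + max q.2.2.1 0).toNat ∧
    (∀ i, 1 ≤ i → i ≤ 4 → a i ≤ c i) ∧
    IsPrin K 0 4 s a pa ∧ inComp K (Set.Icc 1 3) pa v ∧
    0 ≤ (q.2.1 : ℤ) + q.2.2.1 ∧ 0 ≤ (a 4 : ℤ) - q.2.2.1 ∧
    (∃ s' : (K.sub (Set.Icc 1 3) pa).V, IsSource (K.sub (Set.Icc 1 3) pa) s' ∧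
     ∃ z : (K.sub (Set.Icc 1 3) pa).V,
       IsPrin (K.sub (Set.Icc 1 3) pa) 0 3 s'
         (fun i => if i = 1 then ((q.2.1 : ℤ) + q.2.2.1).toNat
                   else if i = 2 then a 3 else ((a 4 : ℤ) - q.2.2.1).toNat) z ∧
       inComp K (Set.Icc 2 3) z.1 v) ∧
    (∃ stil : (K.sub (Set.Icc 2 3) v).V, IsSource (K.sub (Set.Icc 2 3) v) stil ∧
       applyStr (K.sub (Set.Icc 2 3) v) (diagStr q.2.2.2) stil =
         some ⟨v, Relation.ReflTransGen.refl⟩)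

/-- The polytope of descriptions for a symmetric `A_4`-crystal with parameter
`(c1, c2, c2, c1)`. -/
def QuadC (c1 c2 : ℕ) : Set (ℕ × ℕ × ℤ × ℕ) :=
  {q | q.1 ≤ c1 ∧ q.2.1 ≤ c2 ∧ -(q.2.1 : ℤ) ≤ q.2.2.1 ∧
       q.2.2.1 ≤ (c1 : ℤ) - (q.1 : ℤ) ∧ (q.2.2.2 : ℤ) ≤ (c2 : ℤ) + q.2.2.1}

end

namespace PreGraph

/-- `v` is reached from `u` by `k` successive `i`-edges. -/
def It (K : PreGraph) (i k : ℕ) (u v : K.V) : Prop := optIter (K.F i) k u = some v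

section Iteration

variable {K : PreGraph} {i : ℕ}

theorem it_zero {u v : K.V} : K.It i 0 u v ↔ u = v := by
  simp [It, optIter]

theorem it_succ {k : ℕ} {u v : K.V} :
    K.It i (k + 1) u v ↔ ∃ w, K.F i u = some w ∧ K.It i k w v := by
  simp [It, optIter, Option.bind_eq_some_iff]

theorem it_add {k m : ℕ} {u v : K.V} :
    K.It i (k + m) u v ↔ ∃ w, K.It i k u w ∧ K.It i m w v := by
  induction k generalizing u with
  | zero => simp [it_zero]
  | succ k ih =>
    rw [Nat.add_right_comm]
    simp only [it_succ, ih]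
    grind

theorem it_one {u v : K.V} : K.It i 1 u v ↔ K.F i u = some v := by
  simp [it_succ (k := 0), it_zero]

theorem it_succ_last {k : ℕ} {u v : K.V} :
    K.It i (k + 1) u v ↔ ∃ w, K.It i k u w ∧ K.F i w = some v := by
  simp [it_add, it_one]

theorem It.snoc {k : ℕ} {u w v : K.V} (h : K.It i k u w) (h' : K.F i w = some v) :
    K.It i (k + 1) u v := it_succ_last.2 ⟨w, h, h'⟩

theorem It.right_unique {k : ℕ} {u v w : K.V} (h : K.It i k u v) (h' : K.It i k u w) : v = w :=
  Option.some.inj (h.symm.trans h')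

end Iteration

/-- The facts about one color that follow from the monochromatic components being
finite directed paths. -/
structure PathLike (K : PreGraph) : Prop where
  inj : ∀ {i : ℕ} {u u' v : K.V}, K.F i u = some v → K.F i u' = some v → u = u'
  t_step : ∀ {i : ℕ} {u v : K.V}, K.F i u = some v → K.t i v = K.t i u + 1
  h_step : ∀ {i : ℕ} {u v : K.V}, K.F i u = some v → K.h i u = K.h i v + 1
  exists_prev : ∀ {i : ℕ} {v : K.V}, 0 < K.t i v → ∃ u, K.F i u = some v
  exists_next : ∀ {i : ℕ} {u : K.V}, 0 < K.h i u → ∃ v, K.F i u = some v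

theorem _root_.Nat.eq_sSup_of_lower {S : Set ℕ} (h0 : 0 ∈ S) (hd : ∀ k, k + 1 ∈ S → k ∈ S)
    (hb : ∃ k, k ∉ S) (k : ℕ) : k ∈ S ↔ k ≤ sSup S := by
  have hlow : ∀ m k, k + m ∈ S → k ∈ S := by
    intro m
    induction m with
    | zero => simp
    | succ m ih => exact fun k hk => ih k (hd _ hk)
  obtain ⟨b, hb⟩ := hb
  have hbdd : BddAbove S := by
    refine ⟨b, fun x hx => ?_⟩
    by_contra hlt
    refine hb (hlow (x - b) b ?_)
    rwa [Nat.add_sub_of_le (by omega)]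
  refine ⟨fun hk => le_csSup hbdd hk, fun hk => ?_⟩
  refine hlow (sSup S - k) k ?_
  rw [Nat.add_sub_of_le hk]
  exact Nat.sSup_mem ⟨0, h0⟩ hbdd

section Monochromatic

variable {K : PreGraph} {C : Set ℕ} {i : ℕ}

theorem le_h_iff (hK : IsColored K C) (v : K.V) (k : ℕ) :
    (∃ w, K.It i k v w) ↔ k ≤ K.h i v := by
  have key := Nat.eq_sSup_of_lower (S := {k | (optIter (K.F i) k v).isSome = true})
    (by simp [optIter]) ?_ ?_ k
  · simpa [PreGraph.h, It, Option.isSome_iff_exists] using key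
  · intro k hk
    obtain ⟨w, hw⟩ := Option.isSome_iff_exists.1 hk
    obtain ⟨x, hx, -⟩ := it_succ_last.1 (show K.It i (k + 1) v w from hw)
    exact Option.isSome_iff_exists.2 ⟨x, hx⟩
  · by_contra! hall
    have hall' : ∀ k, ∃ w, K.It i k v w := fun k => Option.isSome_iff_exists.1 (hall k)
    choose f hf using hall'
    obtain ⟨hfin, -, -, hac⟩ := hK
    obtain ⟨m, n, hmn, hfmn⟩ := Finite.exists_ne_map_eq_of_infinite f
    wlog hlt : m < n generalizing m n
    · exact this n m hmn.symm hfmn.symm (by omega)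
    have := hf n
    rw [← Nat.add_sub_of_le hlt.le, it_add] at this
    obtain ⟨w, hw, hw'⟩ := this
    obtain rfl := (hf m).right_unique hw
    rw [Nat.add_sub_of_le hlt.le, ← hfmn] at hw'
    exact hac i _ _ (by omega) hw'

theorem le_t_iff (hK : IsColored K C) (v : K.V) (k : ℕ) :
    (∃ u, K.It i k u v) ↔ k ≤ K.t i v := by
  refine Nat.eq_sSup_of_lower (S := {k | ∃ u, K.It i k u v}) ⟨v, it_zero.2 rfl⟩ ?_ ?_ k
  · rintro k ⟨u, hu⟩
    obtain ⟨x, -, hx⟩ := it_succ.1 hu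
    exact ⟨x, hx⟩
  · by_contra! hall
    choose f hf using hall
    obtain ⟨hfin, -, -, hac⟩ := hK
    obtain ⟨m, n, hmn, hfmn⟩ := Finite.exists_ne_map_eq_of_infinite f
    wlog hlt : m < n generalizing m n
    · exact this n m hmn.symm hfmn.symm (by omega)
    have := hf n
    rw [← Nat.add_sub_of_le hlt.le, it_add, Nat.add_sub_of_le hlt.le, ← hfmn] at this
    obtain ⟨w, hw, hw'⟩ := this
    obtain rfl := (hf m).right_unique hw
    exact hac i _ _ (by omega) hw'

theorem pathLike_of_isColored (hK : IsColored K C) : PathLike K := by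
  have inj := hK.2.2.1
  refine ⟨fun {i u u' v} => inj i u u' v, fun {i u v} huv => ?_, fun {i u v} huv => ?_,
    fun {i v} hv => ?_, fun {i u} hu => ?_⟩
  · have key : ∀ k, k + 1 ≤ K.t i v ↔ k ≤ K.t i u := by
      intro k
      rw [← le_t_iff hK, ← le_t_iff hK]
      constructor
      · rintro ⟨x, hx⟩
        obtain ⟨w, hw, hwv⟩ := it_succ_last.1 hx
        exact ⟨x, inj i _ _ _ hwv huv ▸ hw⟩
      · rintro ⟨x, hx⟩
        exact ⟨x, hx.snoc huv⟩
    have h1 := (key (K.t i u)).2 le_rfl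
    have h2 := key (K.t i v - 1)
    omega
  · have key : ∀ k, k + 1 ≤ K.h i u ↔ k ≤ K.h i v := by
      intro k
      rw [← le_h_iff hK, ← le_h_iff hK]
      simp [it_succ, huv]
    have h1 := (key (K.h i v)).2 le_rfl
    have h2 := key (K.h i u - 1)
    omega
  · obtain ⟨u, hu⟩ := (le_t_iff hK v 1).2 hv
    exact ⟨u, it_one.1 hu⟩
  · obtain ⟨v, hv⟩ := (le_h_iff hK u 1).2 hu
    exact ⟨v, it_one.1 hv⟩

end Monochromatic

section PathLike

variable {K : PreGraph} {i : ℕ}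

theorem It.t_eq (hp : PathLike K) {k : ℕ} {u v : K.V} (h : K.It i k u v) :
    K.t i v = K.t i u + k := by
  induction k generalizing v with
  | zero => rw [it_zero.1 h]; rfl
  | succ k ih =>
    obtain ⟨w, hw, hwv⟩ := it_succ_last.1 h
    rw [hp.t_step hwv, ih hw]
    omega

theorem It.left_unique (hp : PathLike K) {k : ℕ} {u u' v : K.V} (h : K.It i k u v)
    (h' : K.It i k u' v) :
    u = u' := by
  induction k generalizing v with
  | zero => rw [it_zero.1 h, it_zero.1 h']
  | succ k ih =>
    obtain ⟨w, hw, hwv⟩ := it_succ_last.1 h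
    obtain ⟨w', hw', hwv'⟩ := it_succ_last.1 h'
    obtain rfl := hp.inj hwv hwv'
    exact ih hw hw'

theorem exists_it_start (hp : PathLike K) (v : K.V) : ∃ u, K.It i (K.t i v) u v ∧ K.t i u = 0 := by
  generalize hn : K.t i v = n
  induction n generalizing v with
  | zero => exact ⟨v, it_zero.2 rfl, hn⟩
  | succ n ih =>
    obtain ⟨w, hw⟩ := hp.exists_prev (i := i) (v := v) (by omega)
    obtain ⟨u, hu, hu0⟩ := ih w (by have := hp.t_step hw; omega)
    exact ⟨u, hu.snoc hw, hu0⟩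

theorem It.unique_start (hp : PathLike K) {k k' : ℕ} {u u' v : K.V} (h : K.It i k u v)
    (h0 : K.t i u = 0)
    (h' : K.It i k' u' v) (h0' : K.t i u' = 0) : k = k' ∧ u = u' := by
  have e := h.t_eq hp
  have e' := h'.t_eq hp
  obtain rfl : k = k' := by omega
  exact ⟨rfl, h.left_unique hp h'⟩

end PathLike

/-- The effect of the axioms (A2), (A3), (A4) on an ordered pair of neighboring colors,
expressed by means of `t` only: an `i`-edge `(u, v)` has label `1` with respect to `j` iff
`t j v = t j u`, and label `0` iff `t j v + 1 = t j u`. -/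
structure NeighbRel (K : PreGraph) (i j : ℕ) : Prop where
  label : ∀ {u v : K.V}, K.F i u = some v → K.t j v = K.t j u ∨ K.t j v + 1 = K.t j u
  convex : ∀ {u v w : K.V}, K.F i u = some v → K.F i v = some w →
    K.t j v = K.t j u → K.t j w = K.t j v
  next_of_one : ∀ {u v : K.V}, K.F i u = some v → K.t j v = K.t j u → ∃ w, K.F j v = some w
  next_of_one_two : ∀ {u v w x : K.V}, K.F i u = some v → K.t j v = K.t j u →
    K.F j v = some w → K.F j w = some x → ∃ y, K.F j u = some y
  next_of_zero : ∀ {u v w : K.V}, K.F i u = some v → K.t j v + 1 = K.t j u →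
    K.F j v = some w → ∃ y, K.F j u = some y
  square : ∀ {u v v' : K.V}, K.F i u = some v → K.F j u = some v' → K.t j v + 1 = K.t j u →
    K.t i v' = K.t i u ∧ ∃ w, K.F j v = some w ∧ K.F i v' = some w
  square' : ∀ {u u' v : K.V}, K.F i u = some v → K.F j u' = some v → K.t j v = K.t j u →
    K.t i v + 1 = K.t i u' ∧ ∃ w, K.F j w = some u ∧ K.F i w = some u'
  verma : ∀ {u v v' : K.V}, K.F i u = some v → K.F j u = some v' →
    K.t j v = K.t j u → K.t i v' = K.t i u →
    ∃ b x b' x' w, K.F j v = some b ∧ K.F j b = some x ∧ K.F i x = some w ∧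
      K.F i v' = some b' ∧ K.F i b' = some x' ∧ K.F j x' = some w

theorem neighbRel_of_isCrystalOn {K : PreGraph} {C : Set ℕ} (hK : IsCrystalOn K C) {i j : ℕ}
    (hi : i ∈ C) (hj : j ∈ C) (hij : Neighb i j) : NeighbRel K i j := by
  have hp := pathLike_of_isColored hK.1
  have hji : Neighb j i := hij.symm
  have hne : i ≠ j := by unfold Neighb at hij; omega
  obtain ⟨-, -, h2, h34, -⟩ := hK
  obtain ⟨h2a, h2b⟩ := h2 i hi j hj hne
  obtain ⟨h2a', -⟩ := h2 j hj i hi hne.symm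
  obtain ⟨⟨h3a, h3b⟩, h4, -⟩ := h34 i hi j hj hij
  have lab : ∀ {u v : K.V}, K.F i u = some v → K.t j v ≤ K.t j u ∧ K.h j u ≤ K.h j v ∧
      K.h j v + K.t j u = K.h j u + K.t j v + 1 := by
    intro u v huv
    obtain ⟨ha, hb, hc⟩ := h2a u v huv
    rw [if_pos hij] at hc
    omega
  have lab' : ∀ {u v : K.V}, K.F j u = some v → K.t i v ≤ K.t i u ∧ K.h i u ≤ K.h i v ∧
      K.h i v + K.t i u = K.h i u + K.t i v + 1 := by
    intro u v huv
    obtain ⟨ha, hb, hc⟩ := h2a' u v huv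
    rw [if_pos hji] at hc
    omega
  constructor
  · intro u v huv
    have := lab huv
    omega
  · intro u v w huv hvw ht
    have := lab huv
    have := lab hvw
    have := h2b u v w huv hvw
    omega
  · intro u v huv ht
    have := lab huv
    exact hp.exists_next (by omega)
  · intro u v w x huv ht hvw hwx
    have := lab huv
    have := hp.h_step hvw
    have := hp.h_step hwx
    exact hp.exists_next (by omega)
  · intro u v w huv ht hvw
    have := lab huv
    have := hp.h_step hvw
    exact hp.exists_next (by omega)
  · intro u v v' huv huv' ht
    have h1 := lab huv
    have h2 := lab' huv'
    obtain ⟨h3, hw⟩ := h3a u v v' huv huv' (by omega)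
    exact ⟨by omega, hw⟩
  · intro u u' v huv hu'v ht
    have h1 := lab huv
    have h2 := lab' hu'v
    obtain ⟨h3, hw⟩ := h3b u u' v huv hu'v (by omega)
    exact ⟨by omega, hw⟩
  · intro u v v' huv huv' ht ht'
    have h1 := lab huv
    have h2 := lab' huv'
    obtain ⟨w, hw, hw'⟩ := h4 u v v' huv huv' (by omega) (by omega)
    simp only [huv, huv', Option.bind_some, Option.bind_eq_some_iff] at hw hw'
    obtain ⟨x, ⟨b, hb, hx⟩, hw⟩ := hw
    obtain ⟨x', ⟨b', hb', hx'⟩, hw'⟩ := hw'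
    exact ⟨b, x, b', x', w, hb, hx, hw, hb', hx', hw'⟩

/-- Both orders of a pair of neighboring colors. -/
structure NeighbPair (K : PreGraph) (i j : ℕ) : Prop where
  path : PathLike K
  left : NeighbRel K i j
  right : NeighbRel K j i

theorem NeighbPair.symm {K : PreGraph} {i j : ℕ} (P : NeighbPair K i j) : NeighbPair K j i :=
  ⟨P.path, P.right, P.left⟩

/-- String coordinates: `u = F_i^k F_j^l F_i^p s` where each power is the longest possible. -/
def Str (K : PreGraph) (i j : ℕ) (s u : K.V) (k l p : ℕ) : Prop :=
  ∃ x b, K.It i k x u ∧ K.t i x = 0 ∧ K.It j l b x ∧ K.t j b = 0 ∧ K.It i p s b ∧ K.t i s = 0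

section Pair

variable {K : PreGraph} {i j : ℕ}

theorem Str.next {s u u' : K.V} {k l p : ℕ} (h : K.Str i j s u k l p)
    (hu : K.F i u = some u') : K.Str i j s u' (k + 1) l p := by
  obtain ⟨x, b, hx, h⟩ := h
  exact ⟨x, b, hx.snoc hu, h⟩

theorem Str.exists_prev {s u : K.V} {k l p : ℕ} (h : K.Str i j s u (k + 1) l p) :
    ∃ v, K.F i v = some u ∧ K.Str i j s v k l p := by
  obtain ⟨x, b, hx, h⟩ := h
  obtain ⟨v, hv, hvu⟩ := it_succ_last.1 hx
  exact ⟨v, hvu, x, b, hv, h⟩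

theorem exists_str (P : NeighbPair K i j) (u : K.V) : ∃ s k l p, K.Str i j s u k l p := by
  obtain ⟨x, hx, hx0⟩ := exists_it_start P.path (i := i) u
  obtain ⟨b, hb, hb0⟩ := exists_it_start P.path (i := j) x
  obtain ⟨s, hs, hs0⟩ := exists_it_start P.path (i := i) b
  exact ⟨s, _, _, _, x, b, hx, hx0, hb, hb0, hs, hs0⟩

theorem Str.unique (P : NeighbPair K i j) {s s' u : K.V} {k l p k' l' p' : ℕ}
    (h : K.Str i j s u k l p)
    (h' : K.Str i j s' u k' l' p') : s = s' ∧ k = k' ∧ l = l' ∧ p = p' := by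
  obtain ⟨x, b, hx, hx0, hb, hb0, hs, hs0⟩ := h
  obtain ⟨x', b', hx', hx0', hb', hb0', hs', hs0'⟩ := h'
  obtain ⟨rfl, rfl⟩ := hx.unique_start P.path hx0 hx' hx0'
  obtain ⟨rfl, rfl⟩ := hb.unique_start P.path hb0 hb' hb0'
  obtain ⟨rfl, rfl⟩ := hs.unique_start P.path hs0 hs' hs0'
  exact ⟨rfl, rfl, rfl, rfl⟩

theorem Str.t_left (P : NeighbPair K i j) {s u : K.V} {k l p : ℕ} (h : K.Str i j s u k l p) :
    K.t i u = k := by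
  obtain ⟨x, b, hx, hx0, -⟩ := h
  rw [hx.t_eq P.path, hx0, zero_add]

theorem verma_labels (P : NeighbPair K i j) {x a a' : K.V} (ha : K.F i x = some a)
    (ha' : K.F j x = some a')
    (h1 : K.t j a = K.t j x) (h1' : K.t i a' = K.t i x) :
    ∃ b c b' c' w, K.F j a = some b ∧ K.F j b = some c ∧ K.F i c = some w ∧
      K.F i a' = some b' ∧ K.F i b' = some c' ∧ K.F j c' = some w ∧
      K.t i b + 1 = K.t i a ∧ K.t i c = K.t i b ∧
      K.t j b' + 1 = K.t j a' ∧ K.t j c' = K.t j b' := by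
  obtain ⟨b, c, b', c', w, hb, hc, hw, hb', hc', hw'⟩ := P.left.verma ha ha' h1 h1'
  refine ⟨b, c, b', c', w, hb, hc, hw, hb', hc', hw', ?_⟩
  have s1 := P.path.t_step ha
  have s2 := P.path.t_step hb
  have s3 := P.path.t_step hc
  have s4 := P.path.t_step hw
  have s1' := P.path.t_step ha'
  have s2' := P.path.t_step hb'
  have s3' := P.path.t_step hc'
  have s4' := P.path.t_step hw'
  have l2 := P.right.label hb
  have l3 := P.right.label hc
  have l4 := P.left.label hw
  have l2' := P.left.label hb'
  have l3' := P.left.label hc'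
  have l4' := P.right.label hw'
  have cv := P.right.convex hb hc
  have cv' := P.left.convex hb' hc'
  have n1 : ¬ K.t j w = K.t j c := by
    intro h
    obtain ⟨e, y, hy, hy'⟩ := P.left.square' hw hw' h
    obtain rfl := P.path.inj hy hc
    obtain rfl := P.path.inj hy' hc'
    omega
  have n2 : ¬ K.t i w = K.t i c' := by
    intro h
    obtain ⟨e, y, hy, hy'⟩ := P.right.square' hw' hw h
    obtain rfl := P.path.inj hy hc'
    obtain rfl := P.path.inj hy' hc
    omega
  omega

/-- A `j`-edge of label `1` commutes with the preceding `i`-edge, whose label is `0`. -/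
theorem square_below (P : NeighbPair K i j) {u v u' : K.V} (hu : K.F j u = some u')
    (ht : K.t i u' = K.t i u)
    (hv : K.F i v = some u) :
    K.t j u + 1 = K.t j v ∧ ∃ w, K.F j v = some w ∧ K.F i w = some u' := by
  have := P.path.t_step hv
  obtain ⟨q, hq⟩ := P.path.exists_prev (i := i) (v := u') (by omega)
  obtain ⟨e, y, hy, hy'⟩ := P.right.square' hu hq ht
  obtain rfl := P.path.inj hy hv
  have := P.path.t_step hu
  have := P.path.t_step hy'
  exact ⟨by omega, q, hy', hq⟩

theorem Str.next_of_label_one (P : NeighbPair K i j) {s u u' : K.V} {k l p : ℕ}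
    (h : K.Str i j s u k l p)
    (hu : K.F j u = some u') (ht : K.t i u' = K.t i u) : K.Str i j s u' k (l + 1) p := by
  induction k generalizing u u' with
  | zero =>
    obtain ⟨x, b, hx, hx0, hb, hb0, hs⟩ := h
    obtain rfl := it_zero.1 hx
    exact ⟨u', b, it_zero.2 rfl, by omega, hb.snoc hu, hb0, hs⟩
  | succ k ih =>
    obtain ⟨v, hv, hstr⟩ := h.exists_prev
    obtain ⟨-, w, hw, hw'⟩ := square_below P hu ht hv
    have := P.path.t_step hv
    have := P.path.t_step hw'
    exact (ih hstr hw (by omega)).next hw'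

theorem label_one_of_zero_below (P : NeighbPair K i j) {u v u' : K.V} (hv : K.F i v = some u)
    (h0 : K.t j u + 1 = K.t j v) (hu : K.F j u = some u') : K.t i u' = K.t i u := by
  obtain ⟨y, hy⟩ := P.left.next_of_zero hv h0 hu
  obtain ⟨e, w, hw, hw'⟩ := P.left.square hv hy h0
  obtain rfl := Option.some.inj (hw.symm.trans hu)
  rw [P.path.t_step hw', P.path.t_step hv, e]

/-- Below a `0`-labeled `i`-edge `(v, u)` there is a `j`-edge of label `1` ending at `v`. -/
theorem label_one_before (P : NeighbPair K i j) {u v : K.V} (hv : K.F i v = some u)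
    (h0 : K.t j u + 1 = K.t j v) :
    ∃ w, K.F j w = some v ∧ K.t i v = K.t i w ∧ K.t j u = K.t j w := by
  obtain ⟨w, hw⟩ := P.path.exists_prev (i := j) (v := v) (by omega)
  have hs := P.path.t_step hw
  refine ⟨w, hw, ?_, by omega⟩
  refine (P.right.label hw).resolve_right fun h => ?_
  obtain ⟨q, hq⟩ := P.right.next_of_zero hw h hv
  obtain ⟨e, y, hy, hy'⟩ := P.right.square hw hq h
  obtain rfl := Option.some.inj (hy.symm.trans hv)
  have := P.path.t_step hy'
  omega

theorem Str.prev_of_label_one (P : NeighbPair K i j) {s u w : K.V} {k l p : ℕ}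
    (h : K.Str i j s u k l p)
    (hw : K.F j w = some u) (ht : K.t i u = K.t i w) :
    ∃ l', l = l' + 1 ∧ K.Str i j s w k l' p := by
  obtain ⟨s', k', l', p', h'⟩ := exists_str P w
  obtain ⟨rfl, rfl, rfl, rfl⟩ := h.unique P (h'.next_of_label_one P hw ht)
  exact ⟨l', rfl, h'⟩

/-- An `i`-edge of label `1` commutes with the whole `j`-path ending at its beginning. -/
theorem shift_path (P : NeighbPair K i j) {x x1 b : K.V} {l : ℕ} (hx : K.F i x = some x1)
    (ht : K.t j x1 = K.t j x)
    (hb : K.It j l b x) (hb0 : K.t j b = 0) :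
    ∃ b1, K.F i b = some b1 ∧ K.It j l b1 x1 ∧ K.t j b1 = 0 ∧ K.t i b1 = K.t i x1 + l := by
  induction l generalizing x x1 with
  | zero =>
    obtain rfl := it_zero.1 hb
    exact ⟨x1, hx, it_zero.2 rfl, by omega, rfl⟩
  | succ l ih =>
    obtain ⟨y, hy, hyx⟩ := it_succ_last.1 hb
    have s1 := P.path.t_step hyx
    obtain ⟨q, hq⟩ := P.path.exists_prev (i := j) (v := x1) (by omega)
    have s2 := P.path.t_step hq
    obtain ⟨e, y', hy', hy'q⟩ := P.left.square' hx hq ht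
    obtain rfl := P.path.inj hy' hyx
    obtain ⟨b1, h1, h2, h3, h4⟩ := ih hy'q (by omega) hy
    exact ⟨b1, h1, h2.snoc hq, h3, by omega⟩

/-- The vertex `x` is not preceded by an `i`-edge of label `1`. -/
theorem Str.critical (P : NeighbPair K i j) {s x x1 y : K.V} {k l p : ℕ} (h : K.Str i j s x k l p)
    (hz : ∀ v, K.F i v = some x → K.t j x + 1 = K.t j v) (hx : K.F i x = some x1)
    (ht : K.t j x1 = K.t j x) (hy : K.F j x1 = some y) :
    K.Str i j s y k (l + 1) (p + 1) ∧ K.t j x = p ∧ l = k + p := by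
  induction k generalizing x x1 y l with
  | zero =>
    obtain ⟨x', b, hx', hx0, hb, hb0, hs, hs0⟩ := h
    obtain rfl := it_zero.1 hx'
    obtain ⟨b1, h1, h2, h3, h4⟩ := shift_path P hx ht hb hb0
    have s1 := P.path.t_step hx
    have s2 := P.path.t_step h1
    have s3 := hs.t_eq P.path
    have s4 := hb.t_eq P.path
    have l1 := P.right.label hy
    have : K.t i y ≠ K.t i x1 := fun e => by
      have := (square_below P hy e hx).1
      omega
    exact ⟨⟨y, b1, it_zero.2 rfl, by omega, h2.snoc hy, h3, hs.snoc h1, hs0⟩, by omega, by omega⟩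
  | succ k ih =>
    obtain ⟨v, hv, hstr⟩ := h.exists_prev
    obtain ⟨w, hw, hwi, hwj⟩ := label_one_before P hv (hz v hv)
    obtain ⟨l', rfl, hstrw⟩ := hstr.prev_of_label_one P hw hwi
    obtain ⟨q, hq⟩ := P.right.next_of_one_two hw hwi hv hx
    have sw := P.path.t_step hw
    have sv := P.path.t_step hv
    have sq := P.path.t_step hq
    have hq1 : K.t j q = K.t j w := by
      refine (P.left.label hq).resolve_right fun h0 => ?_
      obtain ⟨-, y', hy', hyv⟩ := P.left.square hq hw h0
      obtain rfl := Option.some.inj (hyv.symm.trans hv)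
      have sy := P.path.t_step hy'
      obtain ⟨q1, hq1⟩ := P.path.exists_prev (i := j) (v := x1) (by omega)
      have sq1 := P.path.t_step hq1
      obtain ⟨-, y2, hy2, hy2'⟩ := P.left.square' hx hq1 ht
      obtain rfl := P.path.inj hy2 hy'
      obtain ⟨_, _, b', _, _, -, -, -, hb', -, -, -, -, hlab, -⟩ :=
        verma_labels P hy2' hy' (by omega) (by omega)
      obtain rfl := Option.some.inj (hb'.symm.trans hx)
      omega
    obtain ⟨b, c, b', c', y', hb, hc, hcy, hb', hc', hy', -, hcb, -, -⟩ :=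
      verma_labels P hq hw hq1 hwi
    obtain rfl := Option.some.inj (hb'.symm.trans hv)
    obtain rfl := Option.some.inj (hc'.symm.trans hx)
    obtain rfl := Option.some.inj (hy'.symm.trans hy)
    obtain ⟨hsb, hp, hl⟩ := ih hstrw (fun v' hv' => (square_below P hw hwi hv').1) hq hq1 hb
    exact ⟨(hsb.next_of_label_one P hc hcb).next hcy, by omega, by omega⟩

theorem Str.next_of_label_zero (P : NeighbPair K i j) {s u u' : K.V} {k l p : ℕ}
    (h : K.Str i j s u k l p)
    (hu : K.F j u = some u') (ht : K.t i u' + 1 = K.t i u) :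
    ∃ k', k = k' + 1 ∧ K.Str i j s u' k' (l + 1) (p + 1) := by
  induction k generalizing u u' with
  | zero =>
    have := h.t_left P
    omega
  | succ k ih =>
    refine ⟨k, rfl, ?_⟩
    obtain ⟨v, hv, hstr⟩ := h.exists_prev
    have h1 : K.t j u = K.t j v := by
      refine (P.left.label hv).resolve_right fun h0 => ?_
      have := label_one_of_zero_below P hv h0 hu
      omega
    by_cases hz : ∀ w, K.F i w = some v → K.t j v + 1 = K.t j w
    · exact (hstr.critical P hz hv h1 hu).1
    · push Not at hz
      obtain ⟨w, hw, hne⟩ := hz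
      have hw1 := (P.left.label hw).resolve_right hne
      obtain ⟨v', hv'⟩ := P.left.next_of_one hw hw1
      have h0 : K.t i v' + 1 = K.t i v :=
        (P.right.label hv').resolve_left fun e => hne (square_below P hv' e hw).1
      obtain ⟨k', rfl, hstr'⟩ := ih hstr hv' h0
      obtain ⟨-, y, hy, hy'⟩ := P.right.square hv' hv h0
      obtain rfl := Option.some.inj (hy'.symm.trans hu)
      exact hstr'.next hy

theorem It.t_other_le (P : NeighbPair K i j) {b x : K.V} {l : ℕ} (h : K.It j l b x) :
    K.t i b ≤ K.t i x + l := by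
  induction l generalizing x with
  | zero => rw [it_zero.1 h]; rfl
  | succ l ih =>
    obtain ⟨y, hy, hyx⟩ := it_succ_last.1 h
    have := ih hy
    have := P.right.label hyx
    omega

theorem Str.t_right_aux (P : NeighbPair K i j) {s u : K.V} {k l p : ℕ} (h : K.Str i j s u k l p) :
    ((∀ v, K.F i v = some u → K.t j u + 1 = K.t j v) → K.t j u + k = l ∧ p ≤ K.t j u) ∧
    (∀ v, K.F i v = some u → K.t j u = K.t j v → K.t j u = p ∧ l < k + p) := by
  induction k generalizing u l with
  | zero =>
    obtain ⟨x, b, hx, hx0, hb, hb0, hs, hs0⟩ := h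
    obtain rfl := it_zero.1 hx
    have e1 := hb.t_eq P.path
    have e2 := hs.t_eq P.path
    have e3 := hb.t_other_le P
    refine ⟨fun _ => by omega, fun v hv => ?_⟩
    have := P.path.t_step hv
    omega
  | succ k ih =>
    obtain ⟨v, hv, hstr⟩ := h.exists_prev
    refine ⟨fun hz => ?_, fun v' hv' h1 => ?_⟩
    · have h0 := hz v hv
      have hzv : ∀ w, K.F i w = some v → K.t j v + 1 = K.t j w := fun w hw =>
        (P.left.label hw).resolve_left fun e => by
          have := P.left.convex hw hv e
          omega
      obtain ⟨w, hw, hwi, hwj⟩ := label_one_before P hv h0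
      obtain ⟨l', rfl, hstrw⟩ := hstr.prev_of_label_one P hw hwi
      have e1 := (ih hstr).1 hzv
      have e2 := (ih hstrw).1 fun w' hw' => (square_below P hw hwi hw').1
      omega
    · obtain rfl := P.path.inj hv' hv
      by_cases hz : ∀ w, K.F i w = some v' → K.t j v' + 1 = K.t j w
      · obtain ⟨y, hy⟩ := P.left.next_of_one hv' h1
        obtain ⟨-, e1, e2⟩ := hstr.critical P hz hv' h1 hy
        omega
      · push Not at hz
        obtain ⟨w, hw, hne⟩ := hz
        have e := (ih hstr).2 w hw ((P.left.label hw).resolve_right hne)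
        omega

theorem Str.t_right (P : NeighbPair K i j) {s u : K.V} {k l p : ℕ} (h : K.Str i j s u k l p) :
    K.t j u = max p (l - k) := by
  obtain ⟨h0, h1⟩ := h.t_right_aux P
  by_cases hz : ∀ v, K.F i v = some u → K.t j u + 1 = K.t j v
  · have := h0 hz
    omega
  · push Not at hz
    obtain ⟨v, hv, hne⟩ := hz
    have := h1 v hv ((P.left.label hv).resolve_right hne)
    omega

theorem Str.le (P : NeighbPair K i j) {s u : K.V} {k l p : ℕ} (h : K.Str i j s u k l p) :
    p ≤ l := by
  obtain ⟨x, b, -, hx0, hb, -, hs, hs0⟩ := h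
  have e2 := hs.t_eq P.path
  have e3 := hb.t_other_le P
  omega

/-- The action of the color `j` in string coordinates. -/
theorem Str.next_right (P : NeighbPair K i j) {s u u' : K.V} {k l p : ℕ} (h : K.Str i j s u k l p)
    (hu : K.F j u = some u') :
    (k + p ≤ l ∧ K.Str i j s u' k (l + 1) p) ∨
      (l < k + p ∧ ∃ k', k = k' + 1 ∧ K.Str i j s u' k' (l + 1) (p + 1)) := by
  obtain ⟨h0, h1⟩ := h.t_right_aux P
  by_cases hz : ∀ v, K.F i v = some u → K.t j u + 1 = K.t j v
  · have e := h0 hz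
    refine Or.inl ⟨by omega, h.next_of_label_one P hu ?_⟩
    by_cases ht : 0 < K.t i u
    · obtain ⟨v, hv⟩ := P.path.exists_prev ht
      exact label_one_of_zero_below P hv (hz v hv) hu
    · have := P.right.label hu
      omega
  · push Not at hz
    obtain ⟨v, hv, hne⟩ := hz
    have e := h1 v hv ((P.left.label hv).resolve_right hne)
    refine Or.inr ⟨e.2, h.next_of_label_zero P hu ?_⟩
    exact (P.right.label hu).resolve_left fun e => hne (square_below P hu e hv).1

end Pair

/-- The effect of the axioms (A2), (A5) on an ordered pair of distant colors. -/
structure FarRel (K : PreGraph) (i j : ℕ) : Prop where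
  t_eq : ∀ {u v : K.V}, K.F i u = some v → K.t j v = K.t j u
  square : ∀ {u v w : K.V}, K.F i u = some v → K.F j u = some w →
    ∃ x, K.F j v = some x ∧ K.F i w = some x
  swap : ∀ {u v w : K.V}, K.F i u = some v → K.F j v = some w →
    ∃ x, K.F j u = some x ∧ K.F i x = some w

theorem F_of_Finv_eq_some {K : PreGraph} {i : ℕ} {u v : K.V} (h : K.Finv i v = some u) :
    K.F i u = some v := by
  unfold Finv at h
  split_ifs at h with hex
  rw [← Option.some.inj h]
  exact hex.choose_spec

theorem Finv_eq_some {K : PreGraph} (hp : PathLike K) {i : ℕ} {u v : K.V}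
    (h : K.F i u = some v) : K.Finv i v = some u := by
  have hex : ∃ u, K.F i u = some v := ⟨u, h⟩
  rw [Finv, dif_pos hex, hp.inj hex.choose_spec h]

theorem farRel_of_isCrystalOn {K : PreGraph} {C : Set ℕ} (hK : IsCrystalOn K C) {i j : ℕ}
    (hi : i ∈ C) (hj : j ∈ C) (hij : Far i j) : FarRel K i j := by
  have hp := pathLike_of_isColored hK.1
  obtain ⟨-, -, h2, -, h5⟩ := hK
  have hne : i ≠ j := by unfold Far at hij; omega
  have hnn : ¬ Neighb i j := by unfold Far at hij; unfold Neighb; omega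
  have h2a := (h2 i hi j hj hne).1
  have h5 := h5 i hi j hj hij
  refine ⟨fun {u v} huv => ?_, fun {u v w} huv huw => ?_, fun {u v w} huv hvw => ?_⟩
  · obtain ⟨ha, hb, hc⟩ := h2a u v huv
    rw [if_neg hnn] at hc
    omega
  · obtain ⟨x, hx, hx'⟩ := h5 (K.F i) (by simp) (K.F j) (by simp) u (by simp [huv]) (by simp [huw])
    rw [huv] at hx
    rw [huw] at hx'
    exact ⟨x, hx, hx'⟩
  · have hvu := Finv_eq_some hp huv
    obtain ⟨x, hx, hx'⟩ := h5 (K.Finv i) (by simp) (K.F j) (by simp) v (by simp [hvu])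
      (by simp [hvw])
    rw [hvu] at hx
    rw [hvw] at hx'
    exact ⟨x, hx, F_of_Finv_eq_some hx'⟩

section FarRel

variable {K : PreGraph} {i j : ℕ}

theorem It.t_far (hf : FarRel K i j) {m : ℕ} {u v : K.V} (h : K.It i m u v) :
    K.t j v = K.t j u := by
  induction m generalizing v with
  | zero => rw [it_zero.1 h]
  | succ m ih =>
    obtain ⟨w, hw, hwv⟩ := it_succ_last.1 h
    rw [hf.t_eq hwv, ih hw]

theorem It.swap_edge (hf : FarRel K i j) {m : ℕ} {u v w : K.V} (h : K.It i m u v)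
    (h' : K.F j v = some w) :
    ∃ x, K.F j u = some x ∧ K.It i m x w := by
  induction m generalizing v w with
  | zero =>
    obtain rfl := it_zero.1 h
    exact ⟨w, h', it_zero.2 rfl⟩
  | succ m ih =>
    obtain ⟨y, hy, hyv⟩ := it_succ_last.1 h
    obtain ⟨z, hz, hzw⟩ := hf.swap hyv h'
    obtain ⟨x, hx, hxz⟩ := ih hy hz
    exact ⟨x, hx, hxz.snoc hzw⟩

theorem It.swap (hf : FarRel K i j) {m n : ℕ} {u v w : K.V} (h : K.It i m u v) (h' : K.It j n v w) :
    ∃ x, K.It j n u x ∧ K.It i m x w := by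
  induction n generalizing w with
  | zero =>
    obtain rfl := it_zero.1 h'
    exact ⟨u, it_zero.2 rfl, h⟩
  | succ n ih =>
    obtain ⟨y, hy, hyw⟩ := it_succ_last.1 h'
    obtain ⟨z, hz, hzy⟩ := ih hy
    obtain ⟨x, hx, hxw⟩ := hzy.swap_edge hf hyw
    exact ⟨x, hz.snoc hx, hxw⟩

end FarRel

/-- Iterating the color `j` from a vertex that begins a `j`-path. -/
theorem Str.iter_right {K : PreGraph} {i j : ℕ} (P : NeighbPair K i j) {s b x : K.V}
    {k l m : ℕ} (h : K.Str i j s b k l 0) (hlk : l ≤ k) (hx : K.It j m b x) :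
    K.Str i j s x (max l (k - m)) (l + m) (min m (k - l)) := by
  induction m generalizing x with
  | zero =>
    obtain rfl := it_zero.1 hx
    convert h using 1 <;> omega
  | succ m ih =>
    obtain ⟨y, hy, hyx⟩ := it_succ_last.1 hx
    rcases (ih hy).next_right P hyx with ⟨hc, h'⟩ | ⟨hc, k', hk', h'⟩
    · convert h' using 1 <;> omega
    · convert h' using 1 <;> omega

/-- The relations between the colors of an `A_3`-crystal. -/
structure ThreeColors (K : PreGraph) : Prop where
  pair12 : NeighbPair K 1 2
  pair32 : NeighbPair K 3 2
  far13 : FarRel K 1 3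
  far31 : FarRel K 3 1

theorem threeColors_of_isACrystal {K : PreGraph} (hK : IsACrystal 3 K) : ThreeColors K := by
  have hp := pathLike_of_isColored hK.1
  have h1 : 1 ∈ Set.Icc 1 3 := by simp
  have h2 : 2 ∈ Set.Icc 1 3 := by simp
  have h3 : 3 ∈ Set.Icc 1 3 := by simp
  exact
    { pair12 := ⟨hp, neighbRel_of_isCrystalOn hK h1 h2 (by simp [Neighb]),
        neighbRel_of_isCrystalOn hK h2 h1 (by simp [Neighb])⟩
      pair32 := ⟨hp, neighbRel_of_isCrystalOn hK h3 h2 (by simp [Neighb]),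
        neighbRel_of_isCrystalOn hK h2 h3 (by simp [Neighb])⟩
      far13 := farRel_of_isCrystalOn hK h1 h3 (by simp [Far])
      far31 := farRel_of_isCrystalOn hK h3 h1 (by simp [Far]) }

/-- String coordinates in an `A_3`-crystal:
`u = F_1^k F_2^l F_3^A F_1^p F_2^B F_1^d s`, where each power is the longest possible. -/
def Co (K : PreGraph) (s u : K.V) (d B A k l p : ℕ) : Prop :=
  ∃ x₀ b x, K.Str 1 2 s x₀ p B d ∧ K.t 3 x₀ = 0 ∧ K.It 3 A x₀ b ∧ K.t 2 b = 0 ∧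
    K.It 2 l b x ∧ K.t 1 x = 0 ∧ K.It 1 k x u

section ThreeColors

variable {K : PreGraph}

theorem Co.unique (T : ThreeColors K) {s u : K.V} {d B A k l p d' B' A' k' l' p' : ℕ}
    (h : K.Co s u d B A k l p) (h' : K.Co s u d' B' A' k' l' p') :
    d = d' ∧ B = B' ∧ A = A' ∧ k = k' ∧ l = l' ∧ p = p' := by
  have hp := T.pair12.path
  obtain ⟨x₀, b, x, hs, h3, hA, h2, hl, h1, hk⟩ := h
  obtain ⟨x₀', b', x', hs', h3', hA', h2', hl', h1', hk'⟩ := h'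
  obtain ⟨rfl, rfl⟩ := hk.unique_start hp h1 hk' h1'
  obtain ⟨rfl, rfl⟩ := hl.unique_start hp h2 hl' h2'
  obtain ⟨rfl, rfl⟩ := hA.unique_start hp h3 hA' h3'
  obtain ⟨-, rfl, rfl, rfl⟩ := hs.unique T.pair12 hs'
  exact ⟨rfl, rfl, rfl, rfl, rfl, rfl⟩

/-- The source of the upper subcrystal through a vertex. -/
theorem Co.split (T : ThreeColors K) {s u : K.V} {d B A k l p : ℕ} (h : K.Co s u d B A k l p) :
    ∃ e s', K.Str 1 2 s e 0 B d ∧ K.t 3 e = 0 ∧ K.It 3 A e s' ∧ K.Str 1 2 s' u k l p := by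
  obtain ⟨x₀, b, x, ⟨e, b₀, hx₀, he, hs⟩, h3, hA, h2, hl, h1, hk⟩ := h
  obtain ⟨s', hs', hs'b⟩ := hx₀.swap T.far13 hA
  refine ⟨e, s', ⟨e, b₀, it_zero.2 rfl, he, hs⟩, by rw [← hx₀.t_far T.far13, h3], hs',
    x, b, hk, h1, hl, h2, hs'b, by rw [hs'.t_far T.far31, he]⟩

theorem Co.of_split (T : ThreeColors K) {s u e s' : K.V} {d B A k l p : ℕ}
    (he : K.Str 1 2 s e 0 B d)
    (h3 : K.t 3 e = 0) (hA : K.It 3 A e s') (hu : K.Str 1 2 s' u k l p) :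
    K.Co s u d B A k l p := by
  obtain ⟨x, b, hk, h1, hl, h2, hp, h1'⟩ := hu
  obtain ⟨x', b', hx', he⟩ := he
  obtain rfl := it_zero.1 hx'
  obtain ⟨x₀, hx₀, hA'⟩ := hA.swap T.far31 hp
  exact ⟨x₀, b, x, ⟨x', b', hx₀, he⟩, by rw [hx₀.t_far T.far13, h3], hA', h2, hl, h1, hk⟩

theorem Co.next_one {s u u' : K.V} {d B A k l p : ℕ} (h : K.Co s u d B A k l p)
    (hu : K.F 1 u = some u') : K.Co s u' d B A (k + 1) l p := by
  obtain ⟨x₀, b, x, hs, h3, hA, h2, hl, h1, hk⟩ := h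
  exact ⟨x₀, b, x, hs, h3, hA, h2, hl, h1, hk.snoc hu⟩

theorem Co.next_two (T : ThreeColors K) {s u u' : K.V} {d B A k l p : ℕ} (h : K.Co s u d B A k l p)
    (hu : K.F 2 u = some u') :
    (k + p ≤ l ∧ K.Co s u' d B A k (l + 1) p) ∨
      (l < k + p ∧ ∃ k', k = k' + 1 ∧ K.Co s u' d B A k' (l + 1) (p + 1)) := by
  obtain ⟨e, s', he, h3, hA, hs⟩ := h.split T
  rcases hs.next_right T.pair12 hu with ⟨hc, hs⟩ | ⟨hc, k', hk', hs⟩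
  · exact Or.inl ⟨hc, Co.of_split T he h3 hA hs⟩
  · exact Or.inr ⟨hc, k', hk', Co.of_split T he h3 hA hs⟩

theorem Co.next_three (T : ThreeColors K) {s u u' : K.V} {d B A k l p : ℕ}
    (h : K.Co s u d B A k l p)
    (hu : K.F 3 u = some u') :
    (l + max d (B - p) ≤ A ∧ K.Co s u' d B (A + 1) k l p) ∨
      (A < l + max d (B - p) ∧ p + d ≤ B ∧
        ∃ l', l = l' + 1 ∧ K.Co s u' d (B + 1) (A + 1) k l' p) ∨
      (A < l + max d (B - p) ∧ B < p + d ∧ ∃ l' p', l = l' + 1 ∧ p = p' + 1 ∧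
        K.Co s u' (d + 1) (B + 1) (A + 1) k l' p') := by
  have hp := T.pair12.path
  obtain ⟨x₀, b, x, hs, h3, hA, h2, hl, h1, hk⟩ := h
  have hκ := hs.t_right T.pair12
  obtain ⟨x', hx', hk'⟩ := hk.swap_edge T.far13 hu
  have h1' : K.t 1 x' = 0 := by rw [T.far31.t_eq hx', h1]
  obtain ⟨b₀, hb₀, hb₀2⟩ := exists_it_start hp (i := 2) x₀
  obtain ⟨r, hr, hr3⟩ := exists_it_start hp (i := 3) b₀
  have hstr : K.Str 3 2 r b A (K.t 2 x₀) (K.t 3 b₀) := ⟨x₀, b₀, hA, h3, hb₀, hb₀2, hr, hr3⟩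
  have hbt := hstr.t_right T.pair32
  have hr0 : K.t 3 b₀ = 0 := by omega
  rw [hr0] at hstr hr
  obtain rfl := it_zero.1 hr
  have hstrx := (hstr.iter_right T.pair32 (by omega) hl).next hx'
  have hxt := hstrx.t_right T.pair32
  obtain ⟨b', hb', hb'2⟩ := exists_it_start hp (i := 2) x'
  obtain ⟨r', k', l', p', hstr'⟩ := exists_str T.pair32 b'
  have hbt' := hstr'.t_right T.pair32
  obtain rfl : p' = 0 := by omega
  obtain ⟨rfl, e1, e2, e3⟩ :=
    hstrx.unique T.pair32 (hstr'.iter_right T.pair32 (by omega) hb')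
  obtain ⟨y, c, hy, hy3, hc, hc2, hrc, -⟩ := hstr'
  obtain rfl := it_zero.1 hrc
  have hk'A : k' = A + 1 := by omega
  subst hk'A
  rcases Nat.lt_or_ge A (l + max d (B - p)) with hlt | hle
  · obtain ⟨m, rfl⟩ : ∃ m, l = m + 1 := ⟨l - 1, by omega⟩
    obtain rfl : l' = K.t 2 x₀ + 1 := by omega
    have hm : K.t 2 x' = m := by omega
    rw [hm] at hb'
    obtain ⟨y', hy', hyy⟩ := it_succ_last.1 hc
    obtain rfl := hy'.right_unique hb₀
    rcases hs.next_right T.pair12 hyy with ⟨hcd, hs'⟩ | ⟨hcd, p'', rfl, hs'⟩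
    · exact Or.inr (Or.inl ⟨hlt, by omega, m, rfl, y, b', x', hs', hy3, hy, hb'2, hb', h1', hk'⟩)
    · exact Or.inr (Or.inr ⟨hlt, by omega, m, p'', rfl, rfl,
        y, b', x', hs', hy3, hy, hb'2, hb', h1', hk'⟩)
  · obtain rfl : l' = K.t 2 x₀ := by omega
    have hm : K.t 2 x' = l := by omega
    rw [hm] at hb'
    obtain rfl := hc.right_unique hb₀
    exact Or.inl ⟨hle, _, b', x', hs, h3, hy, hb'2, hb', h1', hk'⟩

end ThreeColors

end PreGraph

theorem applyStr_append (K : PreGraph) (L M : List ℕ) (u : K.V) :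
    applyStr K (L ++ M) u = (applyStr K L u).bind (applyStr K M) := by
  induction L generalizing u with
  | nil => rfl
  | cons i L ih => simp only [List.cons_append, applyStr, ih, Option.bind_assoc]

theorem applyStr_replicate_flatten {K : PreGraph} {L : List ℕ} (Q : ℕ → K.V → Prop)
    (hQ : ∀ n u u', Q n u → applyStr K L u = some u' → Q (n + 1) u') {m n : ℕ} {u v : K.V}
    (hu : Q m u) (hv : applyStr K (List.replicate n L).flatten u = some v) : Q (m + n) v := by
  induction n generalizing m u with
  | zero =>
    obtain rfl : u = v := by simpa [applyStr] using hv
    exact hu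
  | succ n ih =>
    rw [List.replicate_succ, List.flatten_cons, applyStr_append, Option.bind_eq_some_iff] at hv
    obtain ⟨w, hw, hv⟩ := hv
    rw [← Nat.add_assoc, Nat.add_right_comm]
    exact ih (hQ _ _ _ hu hw) hv

namespace PreGraph

section Principal

variable {K : PreGraph}

theorem str_of_isPrin (P : NeighbPair K 1 2) {s z : K.V} (h1 : K.t 1 s = 0) (h2 : K.t 2 s = 0)
    {a : ℕ → ℕ} (h : IsPrin K 0 2 s a z) : K.Str 1 2 s z (a 2) (a 1 + a 2) (a 1) := by
  have hL : prinStr 0 2 a = (List.replicate (a 1) [1, 2]).flatten ++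
      (List.replicate (a 2) [2, 1]).flatten := by
    simp [prinStr, SStr, wStr, List.range_succ]
  rw [IsPrin, prinOpt, hL, applyStr_append, Option.bind_eq_some_iff] at h
  obtain ⟨y, hy, hz⟩ := h
  have hy' := applyStr_replicate_flatten (fun n u => K.Str 1 2 s u 0 n n) ?_ (m := 0)
    ⟨s, s, it_zero.2 rfl, h1, it_zero.2 rfl, h2, it_zero.2 rfl, h1⟩ hy
  · have hz' := applyStr_replicate_flatten (fun n u => K.Str 1 2 s u n (a 1 + n) (a 1)) ?_
      (m := 0) (by simpa using hy') hz
    · simpa using hz'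
    · intro n u u' hu hu'
      simp only [applyStr, Option.bind_eq_some_iff, Option.some.injEq] at hu'
      obtain ⟨v, hv, w, hw, rfl⟩ := hu'
      rcases hu.next_right P hv with ⟨-, hv'⟩ | ⟨hc, -⟩
      · exact hv'.next hw
      · omega
  · intro n u u' hu hu'
    simp only [applyStr, Option.bind_eq_some_iff, Option.some.injEq] at hu'
    obtain ⟨v, hv, w, hw, rfl⟩ := hu'
    rcases (hu.next hv).next_right P hw with ⟨hc, -⟩ | ⟨-, k, hk, hw'⟩
    · omega
    · obtain rfl : k = 0 := by omega
      exact hw'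

theorem co_of_isPrin (T : ThreeColors K) {s z : K.V} (hs : ∀ i, K.t i s = 0)
    {a : ℕ → ℕ} (h : IsPrin K 0 3 s a z) :
    K.Co s z (a 1) (a 1 + a 2) (a 1 + a 2 + a 3) (a 3) (a 2 + a 3) (a 2) := by
  have hL : prinStr 0 3 a = (List.replicate (a 1) [1, 2, 3]).flatten ++
      ((List.replicate (a 2) [2, 1, 3, 2]).flatten ++
        (List.replicate (a 3) [3, 2, 1]).flatten) := by
    simp [prinStr, SStr, wStr, List.range_succ]
  rw [IsPrin, prinOpt, hL, applyStr_append, Option.bind_eq_some_iff] at h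
  obtain ⟨x, hx, h⟩ := h
  rw [applyStr_append, Option.bind_eq_some_iff] at h
  obtain ⟨y, hy, hz⟩ := h
  have hx' := applyStr_replicate_flatten (fun n u => K.Co s u n n n 0 0 0) ?_ (m := 0)
    ⟨s, s, s, ⟨s, s, it_zero.2 rfl, hs 1, it_zero.2 rfl, hs 2, it_zero.2 rfl, hs 1⟩, hs 3,
      it_zero.2 rfl, hs 2, it_zero.2 rfl, hs 1, it_zero.2 rfl⟩ hx
  · rw [zero_add] at hx'
    have hy' := applyStr_replicate_flatten
      (fun n u => K.Co s u (a 1) (a 1 + n) (a 1 + n) 0 n n) ?_ (m := 0) hx' hy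
    · rw [zero_add] at hy'
      have hz' := applyStr_replicate_flatten
        (fun n u => K.Co s u (a 1) (a 1 + a 2) (a 1 + a 2 + n) n (a 2 + n) (a 2)) ?_
        (m := 0) hy' hz
      · rwa [zero_add] at hz'
      · intro n u u' hu hu'
        simp only [applyStr, Option.bind_eq_some_iff, Option.some.injEq] at hu'
        obtain ⟨v₁, h₁, v₂, h₂, v₃, h₃, rfl⟩ := hu'
        rcases hu.next_three T h₁ with ⟨-, hu⟩ | ⟨hc, -⟩ | ⟨hc, -⟩
        · rcases hu.next_two T h₂ with ⟨-, hu⟩ | ⟨hc, -⟩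
          · exact hu.next_one h₃
          · omega
        · omega
        · omega
    · intro n u u' hu hu'
      simp only [applyStr, Option.bind_eq_some_iff, Option.some.injEq] at hu'
      obtain ⟨v₁, h₁, v₂, h₂, v₃, h₃, v₄, h₄, rfl⟩ := hu'
      rcases hu.next_two T h₁ with ⟨-, hu⟩ | ⟨hc, -⟩
      · rcases (hu.next_one h₂).next_three T h₃ with ⟨hc, -⟩ | ⟨-, -, l, hl, hu⟩ | ⟨-, hc, -⟩
        · omega
        · obtain rfl : l = n := by omega
          rcases hu.next_two T h₄ with ⟨hc, -⟩ | ⟨-, k, hk, hu⟩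
          · omega
          · obtain rfl : k = 0 := by omega
            exact hu
        · omega
      · omega
  · intro n u u' hu hu'
    simp only [applyStr, Option.bind_eq_some_iff, Option.some.injEq] at hu'
    obtain ⟨v₁, h₁, v₂, h₂, v₃, h₃, rfl⟩ := hu'
    rcases (hu.next_one h₁).next_two T h₂ with ⟨hc, -⟩ | ⟨-, k, hk, hu⟩
    · omega
    · obtain rfl : k = 0 := by omega
      rcases hu.next_three T h₃ with ⟨hc, -⟩ | ⟨-, hc, -⟩ | ⟨-, -, l, p, hl, hp, hu⟩
      · omega
      · omega
      · obtain rfl : l = 0 := by omega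
        obtain rfl : p = 0 := by omega
        exact hu

/-- The source of a two-colored component is constant along the component. -/
theorem Str.of_inComp (P : NeighbPair K 1 2) {s u v : K.V} {k l p : ℕ}
    (h : K.Str 1 2 s u k l p) (huv : inComp K (Set.Icc 1 2) u v) :
    ∃ k' l' p', K.Str 1 2 s v k' l' p' := by
  have forward : ∀ {s u v : K.V} {k l p i : ℕ}, i ∈ Set.Icc 1 2 → K.Str 1 2 s u k l p →
      K.F i u = some v → ∃ k' l' p', K.Str 1 2 s v k' l' p' := by
    intro s u v k l p i hi h huv
    obtain rfl | rfl : i = 1 ∨ i = 2 := by simp only [Set.mem_Icc] at hi; omega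
    · exact ⟨_, _, _, h.next huv⟩
    · rcases h.next_right P huv with ⟨-, h⟩ | ⟨-, _, -, h⟩
      · exact ⟨_, _, _, h⟩
      · exact ⟨_, _, _, h⟩
  induction huv with
  | refl => exact ⟨k, l, p, h⟩
  | tail _ hst ih =>
    obtain ⟨k', l', p', h'⟩ := ih
    obtain ⟨i, hi, hvw | hwv⟩ := hst
    · exact forward hi h' hvw
    · obtain ⟨s', k₁, l₁, p₁, h₁⟩ := exists_str P _
      obtain ⟨k₂, l₂, p₂, h₂⟩ := forward hi h₁ hwv
      obtain ⟨rfl, -⟩ := h₂.unique P h'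
      exact ⟨_, _, _, h₁⟩

/-- String coordinates along the `2`-colored path through a principal vertex of a
two-colored crystal. -/
theorem Str.of_inComp_two (P : NeighbPair K 1 2) {s z v : K.V} {q₁ q₂ : ℕ}
    (h : K.Str 1 2 s z q₂ (q₁ + q₂) q₁) (hzv : inComp K {2} z v) :
    K.Str 1 2 s v (q₂ + (q₁ - K.t 2 v)) (K.t 2 v + q₂) (min q₁ (K.t 2 v)) := by
  induction hzv with
  | refl =>
    have := h.t_right P
    convert h using 1 <;> omega
  | tail _ hst ih =>
    obtain ⟨i, rfl, hvw | hwv⟩ := hst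
    · have := P.path.t_step hvw
      rcases ih.next_right P hvw with ⟨hc, h'⟩ | ⟨hc, k', hk', h'⟩
      · convert h' using 1 <;> omega
      · convert h' using 1 <;> omega
    · have := P.path.t_step hwv
      obtain ⟨s', k₁, l₁, p₁, h₁⟩ := exists_str P _
      rcases h₁.next_right P hwv with ⟨hc, h'⟩ | ⟨hc, k', hk', h'⟩
      · obtain ⟨rfl, e₁, e₂, e₃⟩ := h'.unique P ih
        convert h₁ using 1 <;> omega
      · obtain ⟨rfl, e₁, e₂, e₃⟩ := h'.unique P ih
        convert h₁ using 1 <;> omega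

end Principal

section Sub

variable {K : PreGraph} {I : Set ℕ} {p : K.V}

theorem F_of_sub_F {i : ℕ} {u w : (K.sub I p).V} (h : (K.sub I p).F i u = some w) :
    K.F i u.1 = some w.1 := by
  simp only [PreGraph.sub] at h
  split_ifs at h with hi
  obtain ⟨x, hx, hxw⟩ := Option.pbind_eq_some_iff.1 h
  rw [← Option.some.inj hxw]
  exact hx

theorem applyStr_of_sub {L : List ℕ} {u w : (K.sub I p).V}
    (h : applyStr (K.sub I p) L u = some w) : applyStr K L u.1 = some w.1 := by
  induction L generalizing u with
  | nil =>
    obtain rfl : u = w := Option.some.inj h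
    rfl
  | cons i L ih =>
    obtain ⟨x, hx, hxw⟩ := Option.bind_eq_some_iff.1 h
    simp only [applyStr, F_of_sub_F hx, Option.bind_some]
    exact ih hxw

theorem t_eq_zero_of_isSource_sub (hp : PathLike K) {s : (K.sub I p).V}
    (hs : IsSource (K.sub I p) s) {i : ℕ} (hi : i ∈ I) : K.t i s.1 = 0 := by
  by_contra hne
  obtain ⟨u, hu⟩ := hp.exists_prev (Nat.pos_of_ne_zero hne)
  refine hs i ⟨u, s.2.tail ⟨i, hi, Or.inr hu⟩⟩ ?_
  simp only [PreGraph.sub, dif_pos hi]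
  exact Option.pbind_eq_some_iff.2 ⟨s.1, hu, rfl⟩

end Sub

section Weights

variable {K : PreGraph}

theorem It.weight_self (hp : PathLike K) {i m : ℕ} {u v : K.V} (h : K.It i m u v) :
    (K.h i v : ℤ) - K.t i v = K.h i u - K.t i u - 2 * m := by
  induction m generalizing v with
  | zero => rw [it_zero.1 h]; simp
  | succ m ih =>
    obtain ⟨w, hw, hwv⟩ := it_succ_last.1 h
    have := ih hw
    have := hp.t_step hwv
    have := hp.h_step hwv
    push_cast
    omega

theorem It.weight_other {i j m : ℕ} (h2 : A2at K i j) {u v : K.V} (h : K.It i m u v) :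
    (K.h j v : ℤ) - K.t j v = K.h j u - K.t j u + if Neighb i j then (m : ℤ) else 0 := by
  induction m generalizing v with
  | zero => rw [it_zero.1 h]; simp
  | succ m ih =>
    obtain ⟨w, hw, hwv⟩ := it_succ_last.1 h
    have := ih hw
    have := (h2.1 w v hwv).2.2
    push_cast
    split_ifs at * <;> omega

theorem Co.h_eq (hK : IsACrystal 3 K) {s u : K.V} (hs : ∀ i, K.t i s = 0)
    {d B A k l p : ℕ} (h : K.Co s u d B A k l p) :
    (K.h 1 u : ℤ) = K.h 1 s + B + l - 2 * d - 2 * p - k ∧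
    (K.h 2 u : ℤ) = K.t 2 u + K.h 2 s + d + p + k + A - 2 * B - 2 * l := by
  have hp := pathLike_of_isColored hK.1
  obtain ⟨e, b, x, ⟨x₁, b₁, hd₁, hx₁, hd₂, hb₁, hd₃, -⟩, -, hA, h2, hl, h1, hk⟩ := h
  have a2 : ∀ i j, i ∈ Set.Icc 1 3 → j ∈ Set.Icc 1 3 → i ≠ j → A2at K i j :=
    fun i j hi hj => hK.2.2.1 i hi j hj
  have h12 := a2 1 2 (by simp) (by simp) (by simp)
  have h21 := a2 2 1 (by simp) (by simp) (by simp)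
  have h31 := a2 3 1 (by simp) (by simp) (by simp)
  have h32 := a2 3 2 (by simp) (by simp) (by simp)
  have n12 : Neighb 1 2 := by simp [Neighb]
  have n21 : Neighb 2 1 := by simp [Neighb]
  have n32 : Neighb 3 2 := by simp [Neighb]
  have n31 : ¬ Neighb 3 1 := by simp [Neighb]
  have e1 := hd₃.weight_self hp
  have e2 := hd₂.weight_other h21
  have e3 := hd₁.weight_self hp
  have e4 := hA.weight_other h31
  have e5 := hl.weight_other h21
  have e6 := hk.weight_self hp
  have f1 := hd₃.weight_other h12
  have f2 := hd₂.weight_self hp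
  have f3 := hd₁.weight_other h12
  have f4 := hA.weight_other h32
  have f5 := hl.weight_self hp
  have f6 := hk.weight_other h12
  have ht := hk.t_eq hp
  simp only [if_pos n12, if_pos n21, if_pos n32, if_neg n31] at e1 e2 e3 e4 e5 e6 f1 f2 f3 f4 f5 f6
  have := hs 1
  have := hs 2
  omega

end Weights

/-- The string coordinates and the relevant lengths at a vertex with a given description. -/
theorem co_of_isDescB {K : PreGraph} (hK : IsACrystal 3 K) {s : K.V} (hs : IsSource K s)
    {c : ℕ → ℕ} (hc : ∀ i, 1 ≤ i → i ≤ 3 → K.h i s = c i) {v : K.V} {a₁ a₂ m : ℕ} {δ : ℤ}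
    (h : IsDescB K s c v (a₁, a₂, δ, m)) :
    ∃ a₃ q₁ q₂ : ℕ, (a₃ : ℤ) = a₁ + max δ 0 ∧ (q₁ : ℤ) = a₂ + δ ∧ (q₂ : ℤ) = a₃ - δ ∧
      K.Co s v a₁ (a₁ + a₂) (a₁ + a₂ + a₃) (q₂ + (q₁ - m)) (m + q₂) (min q₁ m) ∧
      a₁ ≤ c 1 ∧ a₂ ≤ c 2 ∧ a₃ ≤ c 3 ∧ a₁ + δ ≤ c 1 ∧ a₂ ≤ c 2 + δ ∧
      (K.h 1 v : ℤ) = c 1 - a₁ - δ + max (m - q₁ : ℤ) 0 ∧ m ≤ c 2 + 2 * δ := by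
  have T := threeColors_of_isACrystal hK
  have hp := T.pair12.path
  have hs0 : ∀ i, K.t i s = 0 := fun i => by
    by_contra hne
    obtain ⟨u, hu⟩ := hp.exists_prev (Nat.pos_of_ne_zero hne)
    exact hs i u hu
  obtain ⟨hm, a, pa, h1, h2, h3, hac, hpa, -, hq1, hq2, s', hs', z, hz, hzv⟩ := h
  dsimp only at hm h1 h2 h3 hq1 hq2 hz
  subst hm h1 h2
  have ha1 := hac 1 (by norm_num) (by norm_num)
  have ha2 := hac 2 (by norm_num) (by norm_num)
  have ha3 := hac 3 (by norm_num) (by norm_num)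
  obtain ⟨e, r, he, he3, hA, hr⟩ := (co_of_isPrin T hs0 hpa).split T
  have t1 := t_eq_zero_of_isSource_sub hp hs' (i := 1) (by simp)
  have t2 := t_eq_zero_of_isSource_sub hp hs' (i := 2) (by simp)
  obtain ⟨k', l', p', hr'⟩ := hr.of_inComp T.pair12 s'.2
  obtain ⟨rfl, -⟩ := hr'.unique T.pair12
    ⟨s'.1, s'.1, it_zero.2 rfl, t1, it_zero.2 rfl, t2, it_zero.2 rfl, t1⟩
  have hz' := str_of_isPrin T.pair12 t1 t2 (applyStr_of_sub hz)
  obtain ⟨q₁, hq₁⟩ := Int.eq_ofNat_of_zero_le hq1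
  obtain ⟨q₂, hq₂⟩ := Int.eq_ofNat_of_zero_le hq2
  simp only [if_true, if_neg (show ¬ 2 = 1 by norm_num), hq₁, hq₂, Int.toNat_natCast] at hz'
  have hv := Co.of_split T he he3 hA (hz'.of_inComp_two T.pair12 hzv)
  have hzc := Co.of_split T he he3 hA hz'
  have hz2 := hz'.t_right T.pair12
  obtain ⟨hv1, hv2⟩ := hv.h_eq hK hs0
  obtain ⟨hz1, hz3⟩ := hzc.h_eq hK hs0
  rw [hc 1 (by norm_num) (by norm_num)] at hv1 hz1
  rw [hc 2 (by norm_num) (by norm_num)] at hv2 hz3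
  have h3' : (a 3 : ℤ) = a 1 + max δ 0 := by omega
  generalize K.t 2 v = m at *
  push_cast at hv1 hv2 hz1 hz3
  refine ⟨a 3, q₁, q₂, h3', hq₁.symm, hq₂.symm, hv, ha1, ha2, ha3, ?_, ?_, ?_, ?_⟩
  all_goals clear hc hac h3 h3' hq1 hq2
  · omega
  · omega
  · rcases le_total m q₁ with hle | hle <;> omega
  · rcases le_total m q₁ with hle | hle <;> omega

end PreGraph

theorem wormOK_worm1_iff {c₁ c₂ a₁ a₂ m : ℕ} {δ : ℤ} (h1 : a₁ + max δ 0 ≤ c₁) (h2 : a₂ ≤ c₂)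
    (h3 : 0 ≤ a₂ + δ) (h4 : a₂ ≤ c₂ + δ) (h5 : m ≤ c₂ + 2 * δ) :
    WormOK c₁ c₂ (worm1 (wtupleB a₁ a₂ δ m)) ↔ 0 < c₁ - a₁ - δ + max (m - (a₂ + δ)) 0 := by
  rcases le_or_gt 0 δ with hδ | hδ
  · rw [max_eq_left hδ] at h1
    simp only [wtupleB, if_pos hδ, max_eq_left hδ]
    split_ifs <;> simp only [worm1, true_and] <;> split_ifs <;>
      simp only [WormOK, implies_true, and_true, true_and] <;> omega
  · rw [max_eq_right hδ.le] at h1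
    simp only [wtupleB, if_neg hδ.not_ge, max_eq_right hδ.le]
    split_ifs <;> simp only [worm1, true_and] <;> split_ifs <;>
      simp only [WormOK, implies_true, true_and] <;> omega

theorem extract_F_of_chain {K : PreGraph} {chain : ℕ → K.V → Option K.V} {σ : K.V → K.V}
    {i : ℕ} {u w : K.V} (hu : σ u = u) (hw : σ w = w) (h : chain i u = some w) :
    (extract K chain σ).F i ⟨u, hu⟩ = some ⟨w, hw⟩ := by
  simp only [extract]
  exact Option.pbind_eq_some_iff.2 ⟨w, h, dif_pos hw⟩

theorem wtupleB_eq_worm1 {a₁ a₂ a₃ q₁ q₂ m b₁ b₂ b₃ r₁ r₂ n : ℕ} {δ ε : ℤ}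
    (ha₃ : (a₃ : ℤ) = a₁ + max δ 0) (hq₁ : (q₁ : ℤ) = a₂ + δ) (hq₂ : (q₂ : ℤ) = a₃ - δ)
    (hb₃ : (b₃ : ℤ) = b₁ + max ε 0) (hr₁ : (r₁ : ℤ) = b₂ + ε) (hr₂ : (r₂ : ℤ) = b₃ - ε)
    (hk : r₂ + (r₁ - n) = q₂ + (q₁ - m) + 1)
    (h : (q₂ + m + max a₁ (a₁ + a₂ - min q₁ m) ≤ a₁ + a₂ + a₃ ∧
          b₁ = a₁ ∧ b₂ = a₂ ∧ b₃ = a₃ + 1 ∧ n + r₂ = m + q₂ ∧ min r₁ n = min q₁ m) ∨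
        (a₁ + a₂ + a₃ < q₂ + m + max a₁ (a₁ + a₂ - min q₁ m) ∧ min q₁ m ≤ a₂ ∧
          b₁ = a₁ ∧ b₂ = a₂ + 1 ∧ b₃ = a₃ ∧ n + r₂ + 1 = m + q₂ ∧ min r₁ n = min q₁ m) ∨
        (a₁ + a₂ + a₃ < q₂ + m + max a₁ (a₁ + a₂ - min q₁ m) ∧ a₂ < min q₁ m ∧
          b₁ = a₁ + 1 ∧ b₂ = a₂ ∧ b₃ = a₃ ∧ n + r₂ + 1 = m + q₂ ∧ min r₁ n + 1 = min q₁ m)) :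
    wtupleB b₁ b₂ ε n = worm1 (wtupleB a₁ a₂ δ m) := by
  rcases le_or_gt m q₁ with hm | hm
  · rw [min_eq_right hm] at h
    rcases lt_or_ge δ 0 with hδ | hδ
    · have hε : ε = δ + 1 ∧ n = m ∧ b₁ = a₁ ∧ b₂ = a₂ + 1 := by
        rcases le_total r₁ n with hn | hn
        · rw [min_eq_left hn] at h; omega
        · rw [min_eq_right hn] at h; omega
      obtain ⟨rfl, rfl, rfl, rfl⟩ := hε
      simp only [wtupleB, worm1]
      grind
    · have hε : ε = δ + 1 ∧ n = m ∧ b₁ = a₁ ∧ b₂ = a₂ := by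
        rcases le_total r₁ n with hn | hn
        · rw [min_eq_left hn] at h; omega
        · rw [min_eq_right hn] at h; omega
      obtain ⟨rfl, rfl, rfl, rfl⟩ := hε
      simp only [wtupleB, worm1]
      grind
  · rw [min_eq_left hm.le] at h
    rcases le_or_gt δ 0 with hδ | hδ
    · have hε : (m = q₁ + 1 ∧ ε = δ ∧ n + 1 = m ∨ q₁ + 2 ≤ m ∧ ε = δ - 1 ∧ n + 2 = m) ∧
          b₁ = a₁ ∧ b₂ = a₂ + 1 := by
        rcases le_total r₁ n with hn | hn
        · rw [min_eq_left hn] at h; omega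
        · rw [min_eq_right hn] at h; omega
      obtain ⟨⟨rfl, rfl, hn⟩ | ⟨hm', rfl, rfl⟩, rfl, rfl⟩ := hε
      · simp only [wtupleB, worm1]
        grind
      · simp only [wtupleB, worm1]
        grind
    · have hε : ε = δ - 1 ∧ n + 2 = m ∧ b₁ = a₁ + 1 ∧ b₂ = a₂ := by
        rcases le_total r₁ n with hn | hn
        · rw [min_eq_left hn] at h; omega
        · rw [min_eq_right hn] at h; omega
      obtain ⟨rfl, rfl, rfl, rfl⟩ := hε
      simp only [wtupleB, worm1]
      grind

/-- for a self-complementary vertex `v` of a symmetric `A_3`-crystal: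
(i) if the worm operator `1tilde` does not act at `w(v)` then `F_{1bar}` does not act at
`v`; (ii) if `1tilde` acts at `w(v)` then `F_{1bar}` acts at `v` and
`w(F_{1bar}(v)) = 1tilde(w(v))`. -/
theorem A3_worm_color1
    (K : PreGraph) (hK : IsACrystal 3 K)
    (s : K.V) (hs : IsSource K s)
    (c : ℕ → ℕ) (hc : ∀ i, 1 ≤ i → i ≤ 3 → K.h i s = c i) (hsym : c 3 = c 1)
    (σ : K.V → K.V) (hσb : Function.Bijective σ)
    (hσ : ∀ (i : ℕ) (u v : K.V), K.F i u = some v ↔ K.F (4 - i) (σ u) = some (σ v))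
    (dsc : K.V → ℕ × ℕ × ℤ × ℕ)
    (hdsc : ∀ v : K.V, σ v = v → IsDescB K s c v (dsc v))
    (v : K.V) (hv : σ v = v) :
    (¬ WormOK (c 1) (c 2) (worm1 (wtQ (dsc v))) →
      (extractB K 2 σ).F 1 ⟨v, hv⟩ = none) ∧
    (WormOK (c 1) (c 2) (worm1 (wtQ (dsc v))) →
      ∃ v' : (extractB K 2 σ).V, (extractB K 2 σ).F 1 ⟨v, hv⟩ = some v' ∧
        wtQ (dsc v'.1) = worm1 (wtQ (dsc v))) := by
  have T := PreGraph.threeColors_of_isACrystal hK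
  have hp := T.pair12.path
  have hd := hdsc v hv
  rcases hq : dsc v with ⟨a₁, a₂, δ, m⟩
  rw [hq] at hd
  obtain ⟨a₃, q₁, q₂, ha₃, hq₁, hq₂, hco, ha1, ha2, ha3, hx, hy, hh, hm⟩ :=
    PreGraph.co_of_isDescB hK hs hc hd
  rw [wtQ, wormOK_worm1_iff (by omega) ha2 (by omega) hy hm, ← hq₁, ← hh]
  have hchain : chainB K 2 1 v = (K.F 1 v).bind (K.F 3) := rfl
  refine ⟨fun h0 => ?_, fun hpos => ?_⟩
  · have h1 : K.F 1 v = none := by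
      rw [Option.eq_none_iff_forall_ne_some]
      intro w hw
      have := hp.h_step hw
      omega
    rw [h1] at hchain
    simp only [extractB, extract]
    rw [Option.pbind_eq_none_iff]
    exact Or.inl hchain
  · obtain ⟨v₁, hv₁⟩ := hp.exists_next (i := 1) (u := v) (by omega)
    have hv₃ : K.F 3 v = some (σ v₁) := by
      have := (hσ 1 v v₁).1 hv₁
      rwa [hv] at this
    obtain ⟨w, hw, hw'⟩ := T.far13.square hv₁ hv₃
    have hσw : σ w = w := by
      have := (hσ 3 v₁ w).1 hw
      exact Option.some.inj (this.symm.trans hw')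
    refine ⟨⟨w, hσw⟩, extract_F_of_chain hv hσw (by rw [hchain, hv₁]; exact hw), ?_⟩
    have hd' := hdsc w hσw
    dsimp only
    rcases hq' : dsc w with ⟨b₁, b₂, ε, n⟩
    rw [hq'] at hd'
    obtain ⟨b₃, r₁, r₂, hb₃, hr₁, hr₂, hco', -⟩ := PreGraph.co_of_isDescB hK hs hc hd'
    change wtupleB b₁ b₂ ε n = worm1 (wtupleB a₁ a₂ δ m)
    rcases (hco.next_one hv₁).next_three T hw with
      ⟨hle, h⟩ | ⟨hlt, hle, l, hl, h⟩ | ⟨hlt, hlt', l, p, hl, hp', h⟩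
    all_goals
      obtain ⟨e₁, e₂, e₃, e₄, e₅, e₆⟩ := h.unique T hco'
      refine wtupleB_eq_worm1 ha₃ hq₁ hq₂ hb₃ hr₁ hr₂ e₄.symm ?_
    · refine Or.inl ⟨?_, ?_, ?_, ?_, ?_, e₆.symm⟩ <;> omega
    · refine Or.inr (Or.inl ⟨?_, ?_, ?_, ?_, ?_, ?_, e₆.symm⟩) <;> omega
    · refine Or.inr (Or.inr ⟨?_, ?_, ?_, ?_, ?_, ?_, ?_⟩) <;> omega
end

section
/- Let n>=2 and let K=K(c) be a symmetric A_{2n}-crystal with symmetric extract C. Then: (a) for each color ibar, every connected subgraph of (S,E_{ibar}) is a finite directed path; (b) for colors ibar,jbar with |i-j|>=2, any two of the operators F_{ibar}, F_{ibar}^{-1}, F_{jbar}, F_{jbar}^{-1} commute at every vertex of C where both act, and each connected component of (S, E_{ibar} disjoint-union E_{jbar}) is the Cartesian product of an ibar-path and a jbar-path; (c) for i,j<n with |i-j|=1, every connected component of (S, E_{ibar} disjoint-union E_{jbar}) is an A_2-crystal (satisfies (A1)-(A4) with ibar,jbar neighboring). -/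
open Classical

/-- The relation formed by the edges of color `i`. -/
def PreGraph.Edge (G : PreGraph) (i : ℕ) (u v : G.V) : Prop := G.F i u = some v

/-- The relation formed by the paths whose sequence of colors is `L`. -/
def PreGraph.Path (G : PreGraph) (L : List ℕ) (u v : G.V) : Prop := applyStr G L u = some v

/-- Two relations form commuting squares: any two edges at a common vertex, one from each
relation and in either direction, span a commuting square. -/
def Squares {α : Type} (R T : α → α → Prop) : Prop :=
  (∀ u a b, R u a → T u b → ∃ z, T a z ∧ R b z) ∧
  (∀ v a b, R a v → T b v → ∃ z, T z a ∧ R z b) ∧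
  (∀ x u a, T x u → R u a → ∃ w, R x w ∧ T w a) ∧
  (∀ x u b, R x u → T u b → ∃ w, T x w ∧ R w b)

/-- The edges of color `i` form vertex-disjoint finite directed paths. -/
structure PathColor (G : PreGraph) (i : ℕ) : Prop where
  finite : Finite G.V
  inj : ∀ {u u' v : G.V}, G.Edge i u v → G.Edge i u' v → u = u'
  acyclic : ∀ (v : G.V) (k : ℕ), 0 < k → ¬ G.Path (List.replicate k i) v v

theorem Squares.symm {α : Type} {R T : α → α → Prop} (h : Squares R T) : Squares T R := by
  obtain ⟨h1, h2, h3, h4⟩ := h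
  refine ⟨fun u a b ha hb => ?_, fun v a b ha hb => ?_, h4, h3⟩
  · obtain ⟨z, hz, hz'⟩ := h1 u b a hb ha
    exact ⟨z, hz', hz⟩
  · obtain ⟨z, hz, hz'⟩ := h2 v b a hb ha
    exact ⟨z, hz', hz⟩

theorem Squares.eq_left {α : Type} (T : α → α → Prop) : Squares Eq T := by
  refine ⟨?_, ?_, ?_, ?_⟩
  · rintro u _ b rfl hb
    exact ⟨b, hb, rfl⟩
  · rintro _ a b rfl hb
    exact ⟨b, hb, rfl⟩
  · rintro x u _ hx rfl
    exact ⟨x, rfl, hx⟩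
  · rintro x _ b rfl hb
    exact ⟨b, hb, rfl⟩

theorem Squares.comp_left {α : Type} {R R' T : α → α → Prop} (h : Squares R T)
    (h' : Squares R' T) : Squares (Relation.Comp R R') T := by
  obtain ⟨h1, h2, h3, h4⟩ := h
  obtain ⟨k1, k2, k3, k4⟩ := h'
  refine ⟨?_, ?_, ?_, ?_⟩
  · rintro u a b ⟨m, hm, hma⟩ hb
    obtain ⟨z, hz, hbz⟩ := h1 _ _ _ hm hb
    obtain ⟨y, hy, hzy⟩ := k1 _ _ _ hma hz
    exact ⟨y, hy, z, hbz, hzy⟩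
  · rintro v a b ⟨m, hm, hmv⟩ hb
    obtain ⟨z, hz, hzb⟩ := k2 _ _ _ hmv hb
    obtain ⟨y, hy, hyz⟩ := h2 _ _ _ hm hz
    exact ⟨y, hy, z, hyz, hzb⟩
  · rintro x u a hx ⟨m, hm, hma⟩
    obtain ⟨z, hz, hzm⟩ := h3 _ _ _ hx hm
    obtain ⟨y, hy, hya⟩ := k3 _ _ _ hzm hma
    exact ⟨y, ⟨z, hz, hy⟩, hya⟩
  · rintro x u b ⟨m, hm, hmu⟩ hb
    obtain ⟨z, hz, hzb⟩ := k4 _ _ _ hmu hb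
    obtain ⟨y, hy, hyz⟩ := h4 _ _ _ hm hz
    exact ⟨y, hy, z, hyz, hzb⟩

namespace PreGraph

variable {G : PreGraph}

theorem f_eq_some_iff {i : ℕ} {u v : G.V} : G.F i u = some v ↔ G.Edge i u v := Iff.rfl

theorem Edge.unique {i : ℕ} {u v v' : G.V} (h : G.Edge i u v) (h' : G.Edge i u v') : v = v' :=
  Option.some.inj (h.symm.trans h')

theorem Path.unique {L : List ℕ} {u v v' : G.V} (h : G.Path L u v) (h' : G.Path L u v') :
    v = v' :=
  Option.some.inj (h.symm.trans h')

@[simp]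
theorem path_nil {u v : G.V} : G.Path [] u v ↔ u = v := by
  simp [Path, applyStr]

@[simp]
theorem path_cons {i : ℕ} {L : List ℕ} {u v : G.V} :
    G.Path (i :: L) u v ↔ ∃ x, G.Edge i u x ∧ G.Path L x v := by
  simp [Path, Edge, applyStr, Option.bind_eq_some_iff]

theorem path_singleton {i : ℕ} {u v : G.V} : G.Path [i] u v ↔ G.Edge i u v := by simp

@[simp]
theorem path_append {L M : List ℕ} {u v : G.V} :
    G.Path (L ++ M) u v ↔ ∃ x, G.Path L u x ∧ G.Path M x v := by
  induction L generalizing u with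
  | nil => simp
  | cons i L ih =>
    simp only [List.cons_append, path_cons, ih]
    constructor
    · rintro ⟨x, hx, y, hy, hv⟩
      exact ⟨y, ⟨x, hx, hy⟩, hv⟩
    · rintro ⟨y, ⟨x, hx, hy⟩, hv⟩
      exact ⟨x, hx, y, hy, hv⟩

theorem optIter_eq_some_iff {i k : ℕ} {u v : G.V} :
    optIter (G.F i) k u = some v ↔ G.Path (List.replicate k i) u v := by
  suffices h : optIter (G.F i) k u = applyStr G (List.replicate k i) u by rw [h]; rfl
  induction k generalizing u with
  | zero => rfl
  | succ k ih =>
    simp only [optIter, List.replicate_succ, applyStr]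
    congr 1
    funext x
    exact ih

theorem h_eq (i : ℕ) (u : G.V) :
    G.h i u = sSup {k | ∃ w, G.Path (List.replicate k i) u w} := by
  simp only [h, Option.isSome_iff_exists, optIter_eq_some_iff]

theorem t_eq (i : ℕ) (u : G.V) :
    G.t i u = sSup {k | ∃ w, G.Path (List.replicate k i) w u} := by
  simp only [t, optIter_eq_some_iff]

theorem h_congr {G' : PreGraph} {i i' : ℕ} {u : G.V} {u' : G'.V}
    (hyp : ∀ k, (∃ w, G.Path (List.replicate k i) u w) ↔
      ∃ w, G'.Path (List.replicate k i') u' w) : G.h i u = G'.h i' u' := by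
  simp only [h_eq, hyp]

theorem t_congr {G' : PreGraph} {i i' : ℕ} {u : G.V} {u' : G'.V}
    (hyp : ∀ k, (∃ w, G.Path (List.replicate k i) w u) ↔
      ∃ w, G'.Path (List.replicate k i') w u') : G.t i u = G'.t i' u' := by
  simp only [t_eq, hyp]

theorem Path.injective {L : List ℕ} (hinj : ∀ i ∈ L, PathColor G i) {u u' v : G.V}
    (h : G.Path L u v) (h' : G.Path L u' v) : u = u' := by
  induction L generalizing u u' with
  | nil => simp_all
  | cons i L ih =>
    rw [path_cons] at h h'
    obtain ⟨x, hx, hv⟩ := h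
    obtain ⟨x', hx', hv'⟩ := h'
    obtain rfl := ih (fun j hj => hinj j (List.mem_cons_of_mem _ hj)) hv hv'
    exact (hinj i List.mem_cons_self).inj hx hx'

theorem squares_path_left {L : List ℕ} {T : G.V → G.V → Prop}
    (h : ∀ i ∈ L, Squares (G.Edge i) T) : Squares (G.Path L) T := by
  induction L with
  | nil =>
    have : G.Path [] = Eq := by funext u v; simp
    rw [this]
    exact Squares.eq_left T
  | cons i L ih =>
    have : G.Path (i :: L) = Relation.Comp (G.Edge i) (G.Path L) := by
      funext u v; simp [Relation.Comp]
    rw [this]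
    exact (h i List.mem_cons_self).comp_left (ih fun j hj => h j (List.mem_cons_of_mem _ hj))

theorem squares_path {L M : List ℕ}
    (h : ∀ i ∈ L, ∀ j ∈ M, Squares (G.Edge i) (G.Edge j)) : Squares (G.Path L) (G.Path M) :=
  squares_path_left fun i hi => (squares_path_left fun j hj => (h i hi j hj).symm).symm

/-- String lengths are constant along the edges of a commuting color. -/
theorem h_eq_of_squares {i j : ℕ} (hsq : Squares (G.Edge i) (G.Edge j)) {u v : G.V}
    (e : G.Edge j u v) : G.h i u = G.h i v := by
  refine h_congr fun k => ?_
  obtain ⟨h1, h2, h3, h4⟩ := squares_path_left (L := List.replicate k i) (T := G.Edge j)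
    (fun l hl => by rwa [List.eq_of_mem_replicate hl])
  constructor
  · rintro ⟨w, hw⟩
    obtain ⟨z, -, hz⟩ := h1 _ _ _ hw e
    exact ⟨z, hz⟩
  · rintro ⟨w, hw⟩
    obtain ⟨z, hz, -⟩ := h3 _ _ _ e hw
    exact ⟨z, hz⟩

theorem t_eq_of_squares {i j : ℕ} (hsq : Squares (G.Edge i) (G.Edge j)) {u v : G.V}
    (e : G.Edge j u v) : G.t i u = G.t i v := by
  refine t_congr fun k => ?_
  obtain ⟨h1, h2, h3, h4⟩ := squares_path_left (L := List.replicate k i) (T := G.Edge j)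
    (fun l hl => by rwa [List.eq_of_mem_replicate hl])
  constructor
  · rintro ⟨w, hw⟩
    obtain ⟨z, -, hz⟩ := h4 _ _ _ hw e
    exact ⟨z, hz⟩
  · rintro ⟨w, hw⟩
    obtain ⟨z, -, hz⟩ := h2 _ _ _ hw e
    exact ⟨z, hz⟩

end PreGraph

namespace PathColor

variable {G : PreGraph} {i : ℕ}

theorem finv_eq_some_iff (hG : PathColor G i) {u v : G.V} :
    G.Finv i v = some u ↔ G.Edge i u v := by
  unfold PreGraph.Finv
  split_ifs with hex
  · have hc : G.Edge i hex.choose v := hex.choose_spec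
    constructor
    · intro hu
      rwa [← Option.some.inj hu]
    · intro hu
      rw [hG.inj hc hu]
  · simp only [false_iff]
    exact fun hu => hex ⟨u, hu⟩

/-- Monochromatic paths have fewer edges than the graph has vertices. -/
theorem length_lt (hG : PathColor G i) {k : ℕ} {u v : G.V}
    (p : G.Path (List.replicate k i) u v) : k < Nat.card G.V := by
  have hfin := hG.finite
  have hsplit : ∀ m : Fin (k + 1), ∃ x, G.Path (List.replicate m i) u x ∧
      G.Path (List.replicate (k - m) i) x v := fun m => by
    rw [← PreGraph.path_append, ← List.replicate_add, Nat.add_sub_cancel' (by omega)]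
    exact p
  choose f hf _ using hsplit
  have hne : ∀ a b : Fin (k + 1), a < b → f a ≠ f b := by
    intro a b hab hfab
    have hb := hf b
    rw [← Nat.add_sub_cancel' (Nat.le_of_lt (Fin.lt_def.mp hab)), List.replicate_add,
      PreGraph.path_append] at hb
    obtain ⟨x, hx, hxb⟩ := hb
    rw [← hfab, ← (hf a).unique hx] at hxb
    exact hG.acyclic _ _ (by have := Fin.lt_def.mp hab; omega) hxb
  have hinj : Function.Injective f := by
    intro a b hab
    rcases lt_trichotomy a b with h | h | h
    · exact absurd hab (hne a b h)
    · exact h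
    · exact absurd hab.symm (hne b a h)
  have := Nat.card_le_card_of_injective f hinj
  rw [Nat.card_fin] at this
  omega

theorem exists_path_h (hG : PathColor G i) (u : G.V) :
    ∃ w, G.Path (List.replicate (G.h i u) i) u w := by
  rw [PreGraph.h_eq]
  exact Nat.sSup_mem (s := {k | ∃ w, G.Path (List.replicate k i) u w}) ⟨0, u, by simp⟩
    ⟨_, fun k ⟨w, hw⟩ => (hG.length_lt hw).le⟩

theorem exists_path_t (hG : PathColor G i) (u : G.V) :
    ∃ w, G.Path (List.replicate (G.t i u) i) w u := by
  rw [PreGraph.t_eq]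
  exact Nat.sSup_mem (s := {k | ∃ w, G.Path (List.replicate k i) w u}) ⟨0, u, by simp⟩
    ⟨_, fun k ⟨w, hw⟩ => (hG.length_lt hw).le⟩

theorem le_h (hG : PathColor G i) {k : ℕ} {u w : G.V}
    (p : G.Path (List.replicate k i) u w) : k ≤ G.h i u := by
  rw [PreGraph.h_eq]
  exact le_csSup ⟨_, fun k ⟨w, hw⟩ => (hG.length_lt hw).le⟩ ⟨w, p⟩

theorem le_t (hG : PathColor G i) {k : ℕ} {u w : G.V}
    (p : G.Path (List.replicate k i) w u) : k ≤ G.t i u := by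
  rw [PreGraph.t_eq]
  exact le_csSup ⟨_, fun k ⟨w, hw⟩ => (hG.length_lt hw).le⟩ ⟨w, p⟩

theorem h_edge (hG : PathColor G i) {u v : G.V} (e : G.Edge i u v) :
    G.h i u = G.h i v + 1 := by
  apply le_antisymm
  · obtain ⟨w, hw⟩ := hG.exists_path_h u
    cases hk : G.h i u with
    | zero => omega
    | succ k =>
      rw [hk, List.replicate_succ, PreGraph.path_cons] at hw
      obtain ⟨x, hx, hw⟩ := hw
      rw [← e.unique hx] at hw
      have := hG.le_h hw
      omega
  · obtain ⟨w, hw⟩ := hG.exists_path_h v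
    refine hG.le_h (w := w) ?_
    rw [List.replicate_succ, PreGraph.path_cons]
    exact ⟨v, e, hw⟩

theorem t_edge (hG : PathColor G i) {u v : G.V} (e : G.Edge i u v) :
    G.t i v = G.t i u + 1 := by
  apply le_antisymm
  · obtain ⟨w, hw⟩ := hG.exists_path_t v
    cases hk : G.t i v with
    | zero => omega
    | succ k =>
      rw [hk, List.replicate_succ', PreGraph.path_append] at hw
      obtain ⟨x, hw, hx⟩ := hw
      rw [PreGraph.path_singleton] at hx
      rw [← hG.inj e hx] at hw
      have := hG.le_t hw
      omega
  · obtain ⟨w, hw⟩ := hG.exists_path_t u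
    refine hG.le_t (w := w) ?_
    rw [List.replicate_succ', PreGraph.path_append]
    exact ⟨u, hw, by simpa using e⟩

theorem exists_edge_of_h_pos (hG : PathColor G i) {u : G.V} (hu : 0 < G.h i u) :
    ∃ v, G.Edge i u v := by
  obtain ⟨w, hw⟩ := hG.exists_path_h u
  obtain ⟨k, hk⟩ := Nat.exists_eq_succ_of_ne_zero hu.ne'
  rw [hk, List.replicate_succ, PreGraph.path_cons] at hw
  obtain ⟨x, hx, -⟩ := hw
  exact ⟨x, hx⟩

end PathColor

theorem a5at_iff_squares {G : PreGraph} {i j : ℕ} (hi : PathColor G i) (hj : PathColor G j) :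
    A5at G i j ↔ Squares (G.Edge i) (G.Edge j) := by
  simp only [A5at, Set.mem_insert_iff, Set.mem_singleton_iff, forall_eq_or_imp, forall_eq,
    Option.bind_eq_some_iff, Option.isSome_iff_exists, hi.finv_eq_some_iff, hj.finv_eq_some_iff]
  simp only [PreGraph.f_eq_some_iff]
  constructor
  · rintro ⟨⟨h1, h2⟩, h3, h4⟩
    refine ⟨fun u a b ha hb => ?_, fun v a b ha hb => ?_, fun x u a hx ha => ?_,
      fun x u b hx hb => ?_⟩
    · obtain ⟨w, ⟨a', ha', hw⟩, b', hb', hw'⟩ := h1 u ⟨a, ha⟩ ⟨b, hb⟩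
      rw [← ha.unique ha'] at hw
      rw [← hb.unique hb'] at hw'
      exact ⟨w, hw, hw'⟩
    · obtain ⟨w, ⟨a', ha', hw⟩, b', hb', hw'⟩ := h4 v ⟨a, ha⟩ ⟨b, hb⟩
      rw [← hi.inj ha ha'] at hw
      rw [← hj.inj hb hb'] at hw'
      exact ⟨w, hw, hw'⟩
    · obtain ⟨w, ⟨a', ha', hw⟩, b', hb', hw'⟩ := h2 u ⟨a, ha⟩ ⟨x, hx⟩
      rw [← ha.unique ha'] at hw
      rw [← hj.inj hx hb'] at hw'
      exact ⟨w, hw', hw⟩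
    · obtain ⟨w, ⟨a', ha', hw⟩, b', hb', hw'⟩ := h3 u ⟨x, hx⟩ ⟨b, hb⟩
      rw [← hi.inj hx ha'] at hw
      rw [← hb.unique hb'] at hw'
      exact ⟨w, hw, hw'⟩
  · rintro ⟨h1, h2, h3, h4⟩
    refine ⟨⟨?_, ?_⟩, ?_, ?_⟩
    · rintro u ⟨a, ha⟩ ⟨b, hb⟩
      obtain ⟨z, hz, hz'⟩ := h1 _ _ _ ha hb
      exact ⟨z, ⟨a, ha, hz⟩, b, hb, hz'⟩
    · rintro u ⟨a, ha⟩ ⟨b, hb⟩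
      obtain ⟨z, hz, hz'⟩ := h3 _ _ _ hb ha
      exact ⟨z, ⟨a, ha, hz'⟩, b, hb, hz⟩
    · rintro u ⟨a, ha⟩ ⟨b, hb⟩
      obtain ⟨z, hz, hz'⟩ := h4 _ _ _ ha hb
      exact ⟨z, ⟨a, ha, hz⟩, b, hb, hz'⟩
    · rintro u ⟨a, ha⟩ ⟨b, hb⟩
      obtain ⟨z, hz, hz'⟩ := h2 _ _ _ ha hb
      exact ⟨z, ⟨a, ha, hz⟩, b, hb, hz'⟩

/-- Axiom (A4) in terms of paths. -/
theorem a4at_iff_path {G : PreGraph} {i j : ℕ} (hi : PathColor G i) (hj : PathColor G j) :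
    A4at G i j ↔
      (∀ u v v', G.Edge i u v → G.Edge j u v' →
        (G.h j v : ℤ) - (G.h j u : ℤ) = 1 → (G.h i v' : ℤ) - (G.h i u : ℤ) = 1 →
        ∃ w, G.Path [i, j, j, i] u w ∧ G.Path [j, i, i, j] u w) ∧
      (∀ u u' v, G.Edge i u v → G.Edge j u' v → G.h j v = G.h j u → G.h i v = G.h i u' →
        ∃ w, G.Path [i, j, j, i] w v ∧ G.Path [j, i, i, j] w v) := by
  have hF : ∀ a b u w, (((G.F a u).bind (G.F b)).bind (G.F b)).bind (G.F a) = some w ↔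
      G.Path [a, b, b, a] u w := by
    intro a b u w
    simp [PreGraph.Path, applyStr, Option.bind_assoc]
  have hFinv : ∀ a b, PathColor G a → PathColor G b → ∀ u w,
      (((G.Finv a u).bind (G.Finv b)).bind (G.Finv b)).bind (G.Finv a) = some w ↔
      G.Path [a, b, b, a] w u := by
    intro a b ha hb u w
    simp only [Option.bind_eq_some_iff, ha.finv_eq_some_iff, hb.finv_eq_some_iff,
      PreGraph.path_cons, PreGraph.path_nil]
    constructor
    · rintro ⟨x, ⟨y, ⟨z, h1, h2⟩, h3⟩, h4⟩
      exact ⟨x, h4, y, h3, z, h2, u, h1, rfl⟩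
    · rintro ⟨x, h4, y, h3, z, h2, u', h1, rfl⟩
      exact ⟨x, ⟨y, ⟨z, h1, h2⟩, h3⟩, h4⟩
  simp only [A4at, hF, hFinv i j hi hj, hFinv j i hj hi, PreGraph.f_eq_some_iff]

theorem stepOn_singleton {G : PreGraph} {i : ℕ} {u v : G.V} :
    stepOn G {i} u v ↔ G.Edge i u v ∨ G.Edge i v u := by
  simp [stepOn, PreGraph.f_eq_some_iff]

theorem inComp.symm {G : PreGraph} {I : Set ℕ} {u v : G.V} (h : inComp G I u v) :
    inComp G I v u := by
  induction h with
  | refl => exact Relation.ReflTransGen.refl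
  | tail _ hs ih =>
    obtain ⟨i, hi, he⟩ := hs
    exact Relation.ReflTransGen.head ⟨i, hi, he.symm⟩ ih

theorem inComp.edge {G : PreGraph} {I : Set ℕ} {i : ℕ} (hi : i ∈ I) {v u w : G.V}
    (h : inComp G I v u) (e : G.Edge i u w) : inComp G I v w :=
  Relation.ReflTransGen.tail h ⟨i, hi, Or.inl e⟩

theorem inComp.edge_rev {G : PreGraph} {I : Set ℕ} {i : ℕ} (hi : i ∈ I) {v u w : G.V}
    (h : inComp G I v w) (e : G.Edge i u w) : inComp G I v u :=
  Relation.ReflTransGen.tail h ⟨i, hi, Or.inr e⟩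

namespace PreGraph

variable {G : PreGraph} {I : Set ℕ} {v : G.V}

theorem inComp_of_path {L : List ℕ} (hL : ∀ i ∈ L, i ∈ I) {u w : G.V} (p : G.Path L u w) :
    inComp G I u w := by
  induction L generalizing u with
  | nil =>
    obtain rfl := path_nil.mp p
    exact Relation.ReflTransGen.refl
  | cons i L ih =>
    obtain ⟨x, hx, hp⟩ := path_cons.mp p
    exact Relation.ReflTransGen.head ⟨i, hL i List.mem_cons_self, Or.inl hx⟩
      (ih (fun j hj => hL j (List.mem_cons_of_mem _ hj)) hp)

theorem sub_edge {i : ℕ} (hi : i ∈ I) {u w : (G.sub I v).V} :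
    (G.sub I v).Edge i u w ↔ G.Edge i u.1 w.1 := by
  have hF : (G.sub I v).F i u =
      (G.F i u.1).pbind fun w hw => some ⟨w, u.2.edge hi (Option.mem_def.mp hw)⟩ := dif_pos hi
  rw [← f_eq_some_iff, hF]
  refine Option.pbind_eq_some_iff.trans ?_
  constructor
  · rintro ⟨x, hx, hw⟩
    rw [← Option.some.inj hw]
    exact hx
  · intro hw
    exact ⟨w.1, hw, rfl⟩

theorem sub_path {L : List ℕ} (hL : ∀ i ∈ L, i ∈ I) {u w : (G.sub I v).V} :
    (G.sub I v).Path L u w ↔ G.Path L u.1 w.1 := by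
  induction L generalizing u with
  | nil =>
    rw [path_nil, path_nil]
    exact Subtype.ext_iff
  | cons i L ih =>
    have hi := hL i List.mem_cons_self
    have ih := fun {u} => ih (u := u) fun j hj => hL j (List.mem_cons_of_mem _ hj)
    rw [path_cons, path_cons]
    constructor
    · rintro ⟨x, hx, hp⟩
      exact ⟨x.1, (sub_edge hi).mp hx, ih.mp hp⟩
    · rintro ⟨x, hx, hp⟩
      let x' : (G.sub I v).V := ⟨x, u.2.edge hi hx⟩
      exact ⟨x', (sub_edge (w := x') hi).mpr hx, (ih (u := x')).mpr hp⟩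

theorem exists_sub_path_from {L : List ℕ} (hL : ∀ i ∈ L, i ∈ I) {u : (G.sub I v).V} {w : G.V}
    (p : G.Path L u.1 w) : ∃ w' : (G.sub I v).V, w'.1 = w :=
  ⟨⟨w, Relation.ReflTransGen.trans u.2 (inComp_of_path hL p)⟩, rfl⟩

theorem exists_sub_path_to {L : List ℕ} (hL : ∀ i ∈ L, i ∈ I) {u : (G.sub I v).V} {w : G.V}
    (p : G.Path L w u.1) : ∃ w' : (G.sub I v).V, w'.1 = w :=
  ⟨⟨w, Relation.ReflTransGen.trans u.2 (inComp_of_path hL p).symm⟩, rfl⟩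

theorem sub_h {i : ℕ} (hi : i ∈ I) (u : (G.sub I v).V) : (G.sub I v).h i u = G.h i u.1 := by
  refine h_congr fun k => ?_
  have hL : ∀ j ∈ List.replicate k i, j ∈ I := fun j hj => by
    rwa [List.eq_of_mem_replicate hj]
  constructor
  · rintro ⟨w, hw⟩
    exact ⟨w.1, (sub_path hL).mp hw⟩
  · rintro ⟨w, hw⟩
    obtain ⟨w, rfl⟩ := exists_sub_path_from hL hw
    exact ⟨w, (sub_path hL).mpr hw⟩

theorem sub_t {i : ℕ} (hi : i ∈ I) (u : (G.sub I v).V) : (G.sub I v).t i u = G.t i u.1 := by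
  refine t_congr fun k => ?_
  have hL : ∀ j ∈ List.replicate k i, j ∈ I := fun j hj => by
    rwa [List.eq_of_mem_replicate hj]
  constructor
  · rintro ⟨w, hw⟩
    exact ⟨w.1, (sub_path hL).mp hw⟩
  · rintro ⟨w, hw⟩
    obtain ⟨w, rfl⟩ := exists_sub_path_to hL hw
    exact ⟨w, (sub_path hL).mpr hw⟩

theorem sub_connected : (G.sub I v).Connected := by
  have hroot : ∀ (u : G.V) (hu : inComp G I v u),
      Relation.ReflTransGen (G.sub I v).Step ⟨v, Relation.ReflTransGen.refl⟩ ⟨u, hu⟩ := by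
    intro u hu
    induction hu with
    | refl => exact Relation.ReflTransGen.refl
    | tail hx hs ih =>
      obtain ⟨i, hi, he⟩ := hs
      exact ih.tail ⟨i, he.imp (fun h => (sub_edge hi).mpr h) (fun h => (sub_edge hi).mpr h)⟩
  have hsymm : ∀ {a b : (G.sub I v).V}, Relation.ReflTransGen (G.sub I v).Step a b →
      Relation.ReflTransGen (G.sub I v).Step b a := by
    intro a b hab
    induction hab with
    | refl => exact Relation.ReflTransGen.refl
    | tail _ hs ih =>
      obtain ⟨i, he⟩ := hs
      exact ih.head ⟨i, he.symm⟩
  exact fun a b => (hsymm (hroot a.1 a.2)).trans (hroot b.1 b.2)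

end PreGraph

theorem PathColor.sub {G : PreGraph} {i : ℕ} (hG : PathColor G i) {I : Set ℕ} (hi : i ∈ I)
    (v : G.V) : PathColor (G.sub I v) i where
  finite := by
    have := hG.finite
    exact inferInstanceAs (Finite {u // inComp G I v u})
  inj := fun h h' => Subtype.ext
    (hG.inj ((PreGraph.sub_edge hi).mp h) ((PreGraph.sub_edge hi).mp h'))
  acyclic := fun u k hk p => hG.acyclic u.1 k hk
    ((PreGraph.sub_path fun j hj => by rwa [List.eq_of_mem_replicate hj]).mp p)

theorem A2at.sub {G : PreGraph} {i j : ℕ} (hA : A2at G i j) {I : Set ℕ} (hi : i ∈ I)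
    (hj : j ∈ I) (v : G.V) : A2at (G.sub I v) i j := by
  simp only [A2at, PreGraph.f_eq_some_iff, PreGraph.sub_edge hi, PreGraph.sub_h hj,
    PreGraph.sub_t hj]
  exact ⟨fun u w h => hA.1 u.1 w.1 h, fun u x w h h' => hA.2 u.1 x.1 w.1 h h'⟩

theorem A3at.sub {G : PreGraph} {i j : ℕ} (hA : A3at G i j) {I : Set ℕ} (hi : i ∈ I)
    (hj : j ∈ I) (v : G.V) : A3at (G.sub I v) i j := by
  simp only [A3at, PreGraph.f_eq_some_iff, PreGraph.sub_edge hi, PreGraph.sub_edge hj,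
    PreGraph.sub_h hi, PreGraph.sub_h hj]
  constructor
  · intro u x x' h h' hl
    obtain ⟨hl', w, hw, hw'⟩ := hA.1 u.1 x.1 x'.1 h h' hl
    exact ⟨hl', ⟨w, x.2.edge hj hw⟩, hw, hw'⟩
  · intro u u' x h h' hl
    obtain ⟨hl', w, hw, hw'⟩ := hA.2 u.1 u'.1 x.1 h h' hl
    exact ⟨hl', ⟨w, u.2.edge_rev hj hw⟩, hw, hw'⟩

theorem A4at.sub {G : PreGraph} {i j : ℕ} (hA : A4at G i j) (hGi : PathColor G i)
    (hGj : PathColor G j) {I : Set ℕ} (hi : i ∈ I) (hj : j ∈ I) (v : G.V) :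
    A4at (G.sub I v) i j := by
  rw [a4at_iff_path hGi hGj] at hA
  have hL : ∀ k ∈ [i, j, j, i], k ∈ I := by simp [hi, hj]
  have hM : ∀ k ∈ [j, i, i, j], k ∈ I := by simp [hi, hj]
  simp only [a4at_iff_path (hGi.sub hi v) (hGj.sub hj v), PreGraph.sub_edge hi,
    PreGraph.sub_edge hj, PreGraph.sub_h hi, PreGraph.sub_h hj, PreGraph.sub_path hL,
    PreGraph.sub_path hM]
  constructor
  · intro u x x' h h' hl hl'
    obtain ⟨w, hw, hw'⟩ := hA.1 u.1 x.1 x'.1 h h' hl hl'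
    obtain ⟨w, rfl⟩ := PreGraph.exists_sub_path_from hL hw
    exact ⟨w, hw, hw'⟩
  · intro u u' x h h' hl hl'
    obtain ⟨w, hw, hw'⟩ := hA.2 u.1 u'.1 x.1 h h' hl hl'
    obtain ⟨w, rfl⟩ := PreGraph.exists_sub_path_to hL hw
    exact ⟨w, hw, hw'⟩

/-- Components of two neighboring colors satisfying (A1)–(A4) are `A_2`-crystals. -/
theorem isCrystalOn_sub_pair {G : PreGraph} {i j : ℕ} (hij : Neighb i j) (hi : PathColor G i)
    (hj : PathColor G j) (h2 : A2at G i j ∧ A2at G j i) (h3 : A3at G i j ∧ A3at G j i)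
    (h4 : A4at G i j ∧ A4at G j i) (v : G.V) : IsCrystalOn (G.sub {i, j} v) {i, j} := by
  have mi : i ∈ ({i, j} : Set ℕ) := by simp
  have mj : j ∈ ({i, j} : Set ℕ) := by simp
  have hnone : ∀ k ∉ ({i, j} : Set ℕ), ∀ u, (G.sub {i, j} v).F k u = none := by
    intro k hk u
    simp only [PreGraph.sub, hk, dite_false]
  have hcol : ∀ k ∈ ({i, j} : Set ℕ), PathColor (G.sub {i, j} v) k := by
    rintro k (rfl | rfl)
    · exact hi.sub mi v
    · exact hj.sub mj v
  refine ⟨⟨(hi.sub mi v).finite, hnone, ?_, ?_⟩, PreGraph.sub_connected, ?_, ?_, ?_⟩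
  · intro k u u' w hu hu'
    by_cases hk : k ∈ ({i, j} : Set ℕ)
    · exact (hcol k hk).inj hu hu'
    · simp [hnone k hk] at hu
  · intro k u m hm p
    by_cases hk : k ∈ ({i, j} : Set ℕ)
    · exact (hcol k hk).acyclic u m hm (PreGraph.optIter_eq_some_iff.mp p)
    · obtain ⟨m, rfl⟩ := Nat.exists_eq_succ_of_ne_zero hm.ne'
      simp [optIter, hnone k hk] at p
  · rintro a (rfl | rfl) b (rfl | rfl) hab
    · exact absurd rfl hab
    · exact h2.1.sub mi mj v
    · exact h2.2.sub mj mi v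
    · exact absurd rfl hab
  · rintro a (rfl | rfl) b (rfl | rfl) hab
    · exact absurd hab (by simp [Neighb])
    · exact ⟨h3.1.sub mi mj v, h4.1.sub hi hj mi mj v⟩
    · exact ⟨h3.2.sub mj mi v, h4.2.sub hj hi mj mi v⟩
    · exact absurd hab (by simp [Neighb])
  · rintro a ha b hb hab
    simp only [Set.mem_insert_iff, Set.mem_singleton_iff] at ha hb
    unfold Far at hab
    unfold Neighb at hij
    omega

/-- The vertices of a monochromatic path are determined by their position on it. -/
theorem PathColor.eq_of_t_eq {G : PreGraph} {i : ℕ} (hG : PathColor G i) {u x : G.V}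
    (hline : inComp G {i} u x) (ht : G.t i u = G.t i x) : u = x := by
  have hbase : ∃ b, G.Path (List.replicate (G.t i u) i) b u ∧
      G.Path (List.replicate (G.t i x) i) b x := by
    clear ht
    induction hline with
    | refl =>
      obtain ⟨b, hb⟩ := hG.exists_path_t u
      exact ⟨b, hb, hb⟩
    | @tail x y _ hs ih =>
      obtain ⟨b, hu, hx⟩ := ih
      refine ⟨b, hu, ?_⟩
      rcases stepOn_singleton.mp hs with he | he
      · rw [hG.t_edge he, List.replicate_succ', PreGraph.path_append]
        exact ⟨x, hx, PreGraph.path_singleton.mpr he⟩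
      · rw [hG.t_edge he, List.replicate_succ', PreGraph.path_append] at hx
        obtain ⟨z, hz, hzx⟩ := hx
        rwa [← hG.inj he (PreGraph.path_singleton.mp hzx)] at hz
  obtain ⟨b, hu, hx⟩ := hbase
  rw [ht] at hu
  exact hu.unique hx

/-- An `i`-path contains vertices at all positions. -/
theorem PathColor.exists_position {G : PreGraph} {i : ℕ} (hG : PathColor G i) (u : G.V) {a : ℕ}
    (ha : a ≤ G.t i u + G.h i u) : ∃ x, inComp G {i} u x ∧ G.t i x = a := by
  have hconst : ∀ m x, G.Path (List.replicate m i) u x → G.t i x = G.t i u + m := by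
    intro m
    induction m with
    | zero =>
      intro x hx
      rw [List.replicate_zero, PreGraph.path_nil] at hx
      rw [hx, Nat.add_zero]
    | succ m ih =>
      intro x hx
      rw [List.replicate_succ', PreGraph.path_append] at hx
      obtain ⟨y, hy, hyx⟩ := hx
      rw [hG.t_edge (PreGraph.path_singleton.mp hyx), ih y hy, Nat.add_assoc]
  have hconst' : ∀ m x, G.Path (List.replicate m i) x u → G.t i u = G.t i x + m := by
    intro m
    induction m with
    | zero =>
      intro x hx
      rw [List.replicate_zero, PreGraph.path_nil] at hx
      rw [hx, Nat.add_zero]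
    | succ m ih =>
      intro x hx
      rw [List.replicate_succ, PreGraph.path_cons] at hx
      obtain ⟨y, hy, hyx⟩ := hx
      rw [ih y hyx, hG.t_edge hy, Nat.add_assoc, Nat.add_comm 1]
  have hmem : ∀ m, ∀ j ∈ List.replicate m i, j ∈ ({i} : Set ℕ) := fun m j hj =>
    List.eq_of_mem_replicate hj
  rcases le_total (G.t i u) a with hle | hle
  · obtain ⟨w, hw⟩ := hG.exists_path_h u
    rw [← Nat.add_sub_cancel' (show a - G.t i u ≤ G.h i u by omega), List.replicate_add,
      PreGraph.path_append] at hw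
    obtain ⟨x, hx, -⟩ := hw
    refine ⟨x, PreGraph.inComp_of_path (hmem _) hx, ?_⟩
    rw [hconst _ x hx]
    omega
  · obtain ⟨w, hw⟩ := hG.exists_path_t u
    rw [← Nat.add_sub_cancel' hle, List.replicate_add, PreGraph.path_append] at hw
    obtain ⟨x, -, hx⟩ := hw
    refine ⟨x, (PreGraph.inComp_of_path (hmem _) hx).symm, ?_⟩
    have := hconst' _ x hx
    omega

theorem inComp.mono {G : PreGraph} {I J : Set ℕ} (hIJ : I ⊆ J) {u v : G.V}
    (h : inComp G I u v) : inComp G J u v :=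
  Relation.ReflTransGen.mono (r := stepOn G I) (fun _ _ ⟨i, hi, he⟩ => ⟨i, hIJ hi, he⟩) _ _ h

/-- In a component of two commuting colors, any vertex is reached by moving along the first
color and then along the second one. -/
theorem Squares.exists_corner {G : PreGraph} {i j : ℕ} (hsq : Squares (G.Edge i) (G.Edge j))
    {u w : G.V} (h : inComp G {i, j} u w) : ∃ x, inComp G {i} u x ∧ inComp G {j} x w := by
  have hstep : ∀ {x y w : G.V}, inComp G {j} x y → stepOn G {i} y w →
      ∃ x', stepOn G {i} x x' ∧ inComp G {j} x' w := by
    obtain ⟨h1, h2, h3, h4⟩ := hsq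
    intro x y w hxy
    induction hxy generalizing w with
    | refl => exact fun hw => ⟨w, hw, Relation.ReflTransGen.refl⟩
    | @tail y z _ hs ih =>
      intro hw
      have hsquare : ∃ y', stepOn G {i} y y' ∧ stepOn G {j} y' w := by
        simp only [stepOn_singleton] at hs hw ⊢
        rcases hs with hs | hs <;> rcases hw with hw | hw
        · obtain ⟨q, hq, hq'⟩ := h3 _ _ _ hs hw
          exact ⟨q, Or.inl hq, Or.inl hq'⟩
        · obtain ⟨q, hq, hq'⟩ := h2 _ _ _ hw hs
          exact ⟨q, Or.inr hq', Or.inl hq⟩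
        · obtain ⟨q, hq, hq'⟩ := h1 _ _ _ hw hs
          exact ⟨q, Or.inl hq', Or.inr hq⟩
        · obtain ⟨q, hq, hq'⟩ := h4 _ _ _ hw hs
          exact ⟨q, Or.inr hq', Or.inr hq⟩
      obtain ⟨y', hy', hw'⟩ := hsquare
      obtain ⟨x', hx', hxy'⟩ := ih hy'
      exact ⟨x', hx', hxy'.tail hw'⟩
  induction h with
  | refl => exact ⟨u, Relation.ReflTransGen.refl, Relation.ReflTransGen.refl⟩
  | tail _ hs ih =>
    obtain ⟨x, hx, hxw⟩ := ih
    obtain ⟨k, rfl | rfl, he⟩ := hs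
    · obtain ⟨x', hx', hw'⟩ := hstep hxw ⟨_, rfl, he⟩
      exact ⟨x', hx.tail hx', hw'⟩
    · exact ⟨x, hx, hxw.tail ⟨_, rfl, he⟩⟩

theorem Squares.t_eq_of_inComp {G : PreGraph} {i j : ℕ} (hsq : Squares (G.Edge i) (G.Edge j))
    {u w : G.V} (h : inComp G {j} u w) : G.t i u = G.t i w := by
  induction h with
  | refl => rfl
  | tail _ hs ih =>
    rcases stepOn_singleton.mp hs with he | he
    · exact ih.trans (PreGraph.t_eq_of_squares hsq he)
    · exact ih.trans (PreGraph.t_eq_of_squares hsq he).symm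

theorem Squares.length_eq_of_inComp {G : PreGraph} {i j : ℕ} (hi : PathColor G i)
    (hsq : Squares (G.Edge i) (G.Edge j)) {u w : G.V} (h : inComp G {i, j} u w) :
    G.t i u + G.h i u = G.t i w + G.h i w := by
  have hedge : ∀ k ∈ ({i, j} : Set ℕ), ∀ {a b : G.V}, G.Edge k a b →
      G.t i a + G.h i a = G.t i b + G.h i b := by
    rintro k (rfl | rfl) a b he
    · rw [hi.h_edge he, hi.t_edge he]
      omega
    · rw [PreGraph.t_eq_of_squares hsq he, PreGraph.h_eq_of_squares hsq he]
  induction h with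
  | refl => rfl
  | tail _ hs ih =>
    obtain ⟨k, hk, he | he⟩ := hs
    · exact ih.trans (hedge k hk he)
    · exact ih.trans (hedge k hk he).symm

/-- Components of two commuting colors are Cartesian products of monochromatic paths. -/
theorem Squares.sub_isoVia_boxGraph {G : PreGraph} {i j : ℕ} (hij : i ≠ j) (hi : PathColor G i)
    (hj : PathColor G j) (hsq : Squares (G.Edge i) (G.Edge j)) (v : G.V) :
    IsoVia (G.sub {i, j} v) (boxGraph i j (G.t i v + G.h i v) (G.t j v + G.h j v))
      (fun x => x) := by
  have hli : ∀ u : (G.sub {i, j} v).V, G.t i v + G.h i v = G.t i u.1 + G.h i u.1 := fun u =>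
    hsq.length_eq_of_inComp hi u.2
  have hlj : ∀ u : (G.sub {i, j} v).V, G.t j v + G.h j v = G.t j u.1 + G.h j u.1 := fun u =>
    hsq.symm.length_eq_of_inComp hj (by rw [Set.pair_comm]; exact u.2)
  have hsi : ({i} : Set ℕ) ⊆ {i, j} := by simp
  have hsj : ({j} : Set ℕ) ⊆ {i, j} := by simp
  have mi : i ∈ ({i, j} : Set ℕ) := by simp
  have mj : j ∈ ({i, j} : Set ℕ) := by simp
  let f : (G.sub {i, j} v).V → (boxGraph i j (G.t i v + G.h i v) (G.t j v + G.h j v)).V :=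
    fun u => (⟨G.t i u.1, by have := hli u; omega⟩, ⟨G.t j u.1, by have := hlj u; omega⟩)
  have hext : ∀ u w : (G.sub {i, j} v).V, G.t i u.1 = G.t i w.1 → G.t j u.1 = G.t j w.1 →
      u = w := by
    intro u w hti htj
    obtain ⟨x, hx, hxw⟩ := hsq.exists_corner (Relation.ReflTransGen.trans u.2.symm w.2)
    have hux : u.1 = x := hi.eq_of_t_eq hx (hti.trans (hsq.t_eq_of_inComp hxw).symm)
    have hxw' : x = w.1 :=
      hj.eq_of_t_eq hxw ((hsq.symm.t_eq_of_inComp hx).symm.trans htj)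
    exact Subtype.ext (hux.trans hxw')
  have hbij : Function.Bijective f := by
    constructor
    · intro u w huw
      exact hext u w (congrArg (fun p => p.1.val) huw) (congrArg (fun p => p.2.val) huw)
    · rintro ⟨⟨a, ha⟩, b, hb⟩
      obtain ⟨x, hx, rfl⟩ := hi.exists_position v (Nat.le_of_lt_succ ha)
      have hvx : inComp G {i, j} v x := hx.mono hsi
      obtain ⟨y, hy, rfl⟩ := hj.exists_position x (a := b) (by
        have := hlj ⟨x, hvx⟩
        dsimp only at this
        omega)
      refine ⟨⟨y, Relation.ReflTransGen.trans hvx (hy.mono hsj)⟩, ?_⟩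
      apply Prod.ext
      · exact Fin.ext (hsq.t_eq_of_inComp hy).symm
      · exact Fin.ext rfl
  refine ⟨Equiv.ofBijective f hbij, fun k u w => ?_⟩
  change _ ↔ (boxGraph i j _ _).F k (f u) = some (f w)
  by_cases hki : k = i
  · subst hki
    rw [PreGraph.f_eq_some_iff, PreGraph.sub_edge mi]
    simp only [boxGraph, if_true, Option.dite_none_right_eq_some, Option.some.injEq, f,
      Prod.mk.injEq, Fin.mk.injEq]
    constructor
    · intro he
      have h1 := hi.t_edge he
      have h2 := hi.h_edge he
      have h3 := hli u
      exact ⟨by omega, h1.symm, PreGraph.t_eq_of_squares hsq.symm he⟩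
    · rintro ⟨hlt, h1, h2⟩
      obtain ⟨x, hx⟩ := hi.exists_edge_of_h_pos (u := u.1) (by have := hli u; omega)
      have := hext ⟨x, u.2.edge mi hx⟩ w ((hi.t_edge hx).trans h1)
        ((PreGraph.t_eq_of_squares hsq.symm hx).symm.trans h2)
      rwa [← this]
  · by_cases hkj : k = j
    · subst hkj
      rw [PreGraph.f_eq_some_iff, PreGraph.sub_edge mj]
      simp only [boxGraph, if_true, hki, if_false, Option.dite_none_right_eq_some,
        Option.some.injEq, f, Prod.mk.injEq, Fin.mk.injEq]
      constructor
      · intro he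
        have h1 := hj.t_edge he
        have h2 := hj.h_edge he
        have h3 := hlj u
        exact ⟨by omega, PreGraph.t_eq_of_squares hsq he, h1.symm⟩
      · rintro ⟨hlt, h1, h2⟩
        obtain ⟨x, hx⟩ := hj.exists_edge_of_h_pos (u := u.1) (by have := hlj u; omega)
        have := hext ⟨x, u.2.edge mj hx⟩ w ((PreGraph.t_eq_of_squares hsq hx).symm.trans h1)
          ((hj.t_edge hx).trans h2)
        rwa [← this]
    · simp [PreGraph.sub, boxGraph, hki, hkj]

/-- A crystal of type `A_{2n}` with a bijection `σ` of its vertices that exchanges the colors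
`i` and `2n + 1 - i`. -/
structure SymCrystal (n : ℕ) (K : PreGraph) (σ : K.V → K.V) : Prop where
  crystal : IsACrystal (2 * n) K
  bijective : Function.Bijective σ
  f_iff : ∀ (i : ℕ) (u v : K.V),
    K.F i u = some v ↔ K.F (2 * n + 1 - i) (σ u) = some (σ v)

/-- The sequence of colors in `K` that forms an edge of color `i` in the symmetric extract. -/
def barWord (n i : ℕ) : List ℕ := if i = n then [n, n + 1, n + 1, n] else [i, 2 * n + 1 - i]

theorem extractC_edge {n : ℕ} {K : PreGraph} {σ : K.V → K.V} {i : ℕ} (hi : 1 ≤ i) (hin : i ≤ n)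
    {u w : (extractC K n σ).V} :
    (extractC K n σ).Edge i u w ↔ K.Path (barWord n i) u.1 w.1 := by
  have hchain : chainC K n i u.1 = applyStr K (barWord n i) u.1 := by
    by_cases h : i = n
    · subst h
      simp [chainC, barWord, hi, applyStr, Option.bind_assoc]
    · simp [chainC, barWord, hi, hin, h, applyStr]
  have hF : (extractC K n σ).F i u =
    (chainC K n i u.1).pbind fun w _ => if hw : σ w = w then some ⟨w, hw⟩ else none := rfl
  rw [← PreGraph.f_eq_some_iff, hF, PreGraph.Path, ← hchain]
  refine Option.pbind_eq_some_iff.trans ?_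
  constructor
  · rintro ⟨x, hx, hw⟩
    split_ifs at hw with hσx
    rw [← Option.some.inj hw]
    exact hx
  · intro hw
    exact ⟨w.1, hw, dif_pos w.2⟩

theorem extractC_edge_low {n : ℕ} {K : PreGraph} {σ : K.V → K.V} {i : ℕ} (hi : 1 ≤ i ∧ i < n)
    {u w : (extractC K n σ).V} :
    (extractC K n σ).Edge i u w ↔ ∃ x, K.Edge i u.1 x ∧ K.Edge (2 * n + 1 - i) x w.1 := by
  rw [extractC_edge hi.1 hi.2.le, barWord, if_neg hi.2.ne]
  simp

namespace SymCrystal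

variable {n : ℕ} {K : PreGraph} {σ : K.V → K.V}

theorem pathColor (H : SymCrystal n K σ) (i : ℕ) : PathColor K i where
  finite := H.crystal.1.1
  inj := fun h h' => H.crystal.1.2.2.1 i _ _ _ h h'
  acyclic := fun v k hk p =>
    H.crystal.1.2.2.2 i v k hk (PreGraph.optIter_eq_some_iff.mpr p)

theorem path_injective (H : SymCrystal n K σ) {L : List ℕ} {u u' v : K.V} (p : K.Path L u v)
    (p' : K.Path L u' v) : u = u' :=
  PreGraph.Path.injective (fun i _ => H.pathColor i) p p'

theorem squares (H : SymCrystal n K σ) {i j : ℕ} (hi : 1 ≤ i ∧ i ≤ 2 * n)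
    (hj : 1 ≤ j ∧ j ≤ 2 * n) (hij : Far i j) : Squares (K.Edge i) (K.Edge j) :=
  (a5at_iff_squares (H.pathColor i) (H.pathColor j)).mp (H.crystal.2.2.2.2 i hi j hj hij)

theorem squares_low_high (H : SymCrystal n K σ) {i j : ℕ} (hi : 1 ≤ i ∧ i < n)
    (hj : 1 ≤ j ∧ j < n) : Squares (K.Edge i) (K.Edge (2 * n + 1 - j)) :=
  H.squares (by omega) (by omega) (by unfold Far; omega)

theorem squares_words (H : SymCrystal n K σ) {L M : List ℕ} (hL : ∀ i ∈ L, 1 ≤ i ∧ i < n)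
    (hM : ∀ i ∈ M, 1 ≤ i ∧ i < n) :
    Squares (K.Path L) (K.Path (M.map (2 * n + 1 - ·))) := by
  refine PreGraph.squares_path fun i hi j hj => ?_
  obtain ⟨m, hm, rfl⟩ := List.mem_map.mp hj
  exact H.squares_low_high (hL i hi) (hM m hm)

theorem squares_word_edge (H : SymCrystal n K σ) {L : List ℕ} (hL : ∀ i ∈ L, 1 ≤ i ∧ i < n)
    {j : ℕ} (hj : 1 ≤ j ∧ j < n) : Squares (K.Path L) (K.Edge (2 * n + 1 - j)) :=
  PreGraph.squares_path_left fun i hi => H.squares_low_high (hL i hi) hj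

theorem edge_mirror (H : SymCrystal n K σ) {i : ℕ} {u v : K.V} :
    K.Edge (2 * n + 1 - i) (σ u) (σ v) ↔ K.Edge i u v :=
  (H.f_iff i u v).symm

theorem edge_mirror_symm (H : SymCrystal n K σ) {i : ℕ} (hi : i ≤ 2 * n + 1) {u v : K.V} :
    K.Edge i (σ u) (σ v) ↔ K.Edge (2 * n + 1 - i) u v := by
  have h := H.edge_mirror (i := 2 * n + 1 - i) (u := u) (v := v)
  rwa [Nat.sub_sub_self hi] at h

theorem path_mirror (H : SymCrystal n K σ) {L : List ℕ} {u v : K.V} :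
    K.Path (L.map (2 * n + 1 - ·)) (σ u) (σ v) ↔ K.Path L u v := by
  induction L generalizing u with
  | nil => simpa using H.bijective.1.eq_iff
  | cons i L ih =>
    simp only [List.map_cons, PreGraph.path_cons]
    rw [H.bijective.2.exists]
    simp only [ih, H.edge_mirror]

theorem h_mirror (H : SymCrystal n K σ) (i : ℕ) (u : K.V) :
    K.h (2 * n + 1 - i) (σ u) = K.h i u := by
  refine PreGraph.h_congr fun k => ?_
  rw [H.bijective.2.exists]
  have := fun w => H.path_mirror (L := List.replicate k i) (u := u) (v := w)
  simp only [List.map_replicate] at this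
  simp only [this]

/-- A low color acting on a fixed vertex yields an edge of the extract. -/
theorem exists_bar_from (H : SymCrystal n K σ) {i : ℕ} (hi : 1 ≤ i ∧ i < n) {u x : K.V}
    (hu : σ u = u) (e : K.Edge i u x) :
    ∃ v, σ v = v ∧ K.Edge (2 * n + 1 - i) x v := by
  have e' := H.edge_mirror.mpr e
  rw [hu] at e'
  obtain ⟨v, hv, hv'⟩ := (H.squares_low_high hi hi).1 _ _ _ e e'
  exact ⟨v, ((H.edge_mirror_symm (by omega)).mpr hv).unique hv', hv⟩

theorem exists_bar_to (H : SymCrystal n K σ) {i : ℕ} (hi : 1 ≤ i ∧ i < n) {v x : K.V}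
    (hv : σ v = v) (e : K.Edge i x v) :
    ∃ u, σ u = u ∧ K.Edge (2 * n + 1 - i) u x ∧ K.Edge i u (σ x) ∧
      K.Edge (2 * n + 1 - i) (σ x) v := by
  have e' := H.edge_mirror.mpr e
  rw [hv] at e'
  obtain ⟨u, hu, hu'⟩ := (H.squares_low_high hi hi).2.1 _ _ _ e e'
  exact ⟨u, (H.pathColor i).inj ((H.edge_mirror_symm (by omega)).mpr hu) hu', hu, hu', e'⟩

/-- The two colors forming an edge of the extract may be applied in the opposite order. -/
theorem bar_swap (H : SymCrystal n K σ) {i : ℕ} (hi : 1 ≤ i ∧ i < n)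
    {u v : (extractC K n σ).V} (e : (extractC K n σ).Edge i u v) :
    ∃ x, K.Edge (2 * n + 1 - i) u.1 x ∧ K.Edge i x v.1 := by
  obtain ⟨x, hx, hxv⟩ := (extractC_edge_low hi).mp e
  have h1 := H.edge_mirror.mpr hx
  have h2 := (H.edge_mirror_symm (by omega)).mpr hxv
  rw [u.2] at h1
  rw [v.2] at h2
  exact ⟨_, h1, h2⟩

/-- The involution exchanges the string lengths of the two middle colors. -/
theorem middle_label (H : SymCrystal n K σ) {u x : K.V} (hu : σ u = u) :
    K.h n (σ x) = K.h (n + 1) x ∧ K.h n u = K.h (n + 1) u := by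
  have h1 := H.h_mirror (n + 1) x
  have h2 := H.h_mirror (n + 1) u
  rw [show 2 * n + 1 - (n + 1) = n by omega] at h1 h2
  rw [hu] at h2
  exact ⟨h1, h2⟩

theorem middle_label_eq (H : SymCrystal n K σ) (hn : 1 ≤ n) {u x : K.V}
    (e : K.Edge n u x) :
    K.h (n + 1) x = K.h (n + 1) u ∨ (K.h (n + 1) x : ℤ) - K.h (n + 1) u = 1 := by
  obtain ⟨h1, h2, h3⟩ := (H.crystal.2.2.1 n (Set.mem_Icc.mpr (by omega)) (n + 1)
    (Set.mem_Icc.mpr (by omega)) (by omega)).1 u x e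
  rw [if_pos (show Neighb n (n + 1) from Or.inl rfl)] at h3
  omega

theorem edge_middle_mirror (H : SymCrystal n K σ) {u v : K.V} (e : K.Edge n u v) :
    K.Edge (n + 1) (σ u) (σ v) := by
  have h := H.edge_mirror.mpr e
  rwa [show 2 * n + 1 - n = n + 1 by omega] at h

theorem path_middle_mirror (H : SymCrystal n K σ) {u v : K.V}
    (p : K.Path [n, n + 1, n + 1, n] u v) : K.Path [n + 1, n, n, n + 1] (σ u) (σ v) := by
  have h := H.path_mirror.mpr p
  simpa only [List.map_cons, List.map_nil, show 2 * n + 1 - n = n + 1 by omega,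
    show 2 * n + 1 - (n + 1) = n by omega] using h

theorem fixed_of_middle_path_from (H : SymCrystal n K σ) (hn : 1 ≤ n) {u w : K.V}
    (hu : σ u = u) (p : K.Path [n, n + 1, n + 1, n] u w) : σ w = w := by
  have p' := H.path_middle_mirror p
  rw [hu] at p'
  obtain ⟨x, hx, -⟩ := PreGraph.path_cons.mp p
  have hx' := H.edge_middle_mirror hx
  rw [hu] at hx'
  obtain ⟨l1, l2⟩ := H.middle_label (x := x) hu
  obtain ⟨hA3, hA4⟩ := H.crystal.2.2.2.1 n (Set.mem_Icc.mpr (by omega)) (n + 1)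
    (Set.mem_Icc.mpr (by omega)) (Or.inl rfl)
  rcases H.middle_label_eq hn hx with hl | hl
  · have := (hA3.1 u x (σ x) hx hx' hl).1
    omega
  · rw [a4at_iff_path (H.pathColor n) (H.pathColor (n + 1))] at hA4
    obtain ⟨y, hy, hy'⟩ := hA4.1 u x (σ x) hx hx' hl (by omega)
    rw [← p.unique hy] at hy'
    exact p'.unique hy'

theorem fixed_of_middle_path_to (H : SymCrystal n K σ) (hn : 1 ≤ n) {u w : K.V}
    (hw : σ w = w) (p : K.Path [n, n + 1, n + 1, n] u w) : σ u = u := by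
  have p' := H.path_middle_mirror p
  rw [hw] at p'
  have hlast : ∃ x, K.Edge n x w := by
    simp only [PreGraph.path_cons, PreGraph.path_nil] at p
    obtain ⟨_, _, _, _, x, _, _, hx, rfl⟩ := p
    exact ⟨x, hx⟩
  obtain ⟨x, hx⟩ := hlast
  have hx' := H.edge_middle_mirror hx
  rw [hw] at hx'
  obtain ⟨l1, l2⟩ := H.middle_label (x := x) hw
  obtain ⟨hA3, hA4⟩ := H.crystal.2.2.2.1 n (Set.mem_Icc.mpr (by omega)) (n + 1)
    (Set.mem_Icc.mpr (by omega)) (Or.inl rfl)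
  rcases H.middle_label_eq hn hx with hl | hl
  · rw [a4at_iff_path (H.pathColor n) (H.pathColor (n + 1))] at hA4
    obtain ⟨y, hy, hy'⟩ := hA4.2 x (σ x) w hx hx' hl (by omega)
    rw [← H.path_injective p hy] at hy'
    exact H.path_injective p' hy'
  · have := (hA3.2 x (σ x) w hx hx' hl).1
    omega

theorem fixed_of_barWord_from (H : SymCrystal n K σ) {i : ℕ} (hi : 1 ≤ i) (hin : i ≤ n)
    {u w : K.V} (hu : σ u = u) (p : K.Path (barWord n i) u w) : σ w = w := by
  unfold barWord at p
  split_ifs at p with h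
  · exact H.fixed_of_middle_path_from (hi.trans hin) hu p
  · obtain ⟨x, hx, hxw⟩ := PreGraph.path_cons.mp p
    obtain ⟨v, hv, hxv⟩ := H.exists_bar_from ⟨hi, by omega⟩ hu hx
    rwa [(PreGraph.path_singleton.mp hxw).unique hxv]

theorem fixed_of_barWord_to (H : SymCrystal n K σ) {i : ℕ} (hi : 1 ≤ i) (hin : i ≤ n)
    {u w : K.V} (hw : σ w = w) (p : K.Path (barWord n i) u w) : σ u = u := by
  unfold barWord at p
  split_ifs at p with h
  · exact H.fixed_of_middle_path_to (hi.trans hin) hw p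
  · obtain ⟨x, hx, hxw⟩ := PreGraph.path_cons.mp p
    rw [PreGraph.path_singleton] at hxw
    have hx' := H.edge_mirror.mpr hx
    have hxw' := (H.edge_mirror_symm (by omega)).mpr hxw
    rw [hw] at hxw'
    obtain ⟨z, hz, -, hz', hxw''⟩ := H.exists_bar_to ⟨hi, by omega⟩ hw hxw'
    rw [← (H.pathColor _).inj hxw hxw''] at hz'
    rwa [(H.pathColor _).inj hx hz']

theorem mem_barWord {i k : ℕ} (hk : k ∈ barWord n i) :
    k = i ∨ k = 2 * n + 1 - i := by
  unfold barWord at hk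
  split_ifs at hk with h
  · simp only [List.mem_cons, List.not_mem_nil, or_false] at hk
    omega
  · simpa using hk

/-- Distant colors of the extract commute. -/
theorem extract_squares (H : SymCrystal n K σ) {i j : ℕ} (hi : 1 ≤ i) (hin : i ≤ n)
    (hj : 1 ≤ j) (hjn : j ≤ n) (hij : Far i j) :
    Squares ((extractC K n σ).Edge i) ((extractC K n σ).Edge j) := by
  obtain ⟨h1, h2, h3, h4⟩ : Squares (K.Path (barWord n i)) (K.Path (barWord n j)) := by
    refine PreGraph.squares_path fun a ha b hb => ?_
    unfold Far at hij
    rcases mem_barWord ha with rfl | rfl <;> rcases mem_barWord hb with rfl | rfl <;>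
      exact H.squares (by omega) (by omega) (by unfold Far; omega)
  simp only [Squares, extractC_edge hi hin, extractC_edge hj hjn]
  refine ⟨fun u a b ha hb => ?_, fun u a b ha hb => ?_, fun x u a hx ha => ?_,
    fun x u b hx hb => ?_⟩
  · obtain ⟨z, hz, hz'⟩ := h1 _ _ _ ha hb
    exact ⟨⟨z, H.fixed_of_barWord_from hj hjn a.2 hz⟩, hz, hz'⟩
  · obtain ⟨z, hz, hz'⟩ := h2 _ _ _ ha hb
    exact ⟨⟨z, H.fixed_of_barWord_to hj hjn a.2 hz⟩, hz, hz'⟩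
  · obtain ⟨z, hz, hz'⟩ := h3 _ _ _ hx ha
    exact ⟨⟨z, H.fixed_of_barWord_from hi hin x.2 hz⟩, hz, hz'⟩
  · obtain ⟨z, hz, hz'⟩ := h4 _ _ _ hx hb
    exact ⟨⟨z, H.fixed_of_barWord_from hj hjn x.2 hz⟩, hz, hz'⟩

/-- Each edge of color `i` of the extract lowers the `i`-weight of `K` by two. -/
theorem weight_barWord (H : SymCrystal n K σ) {i : ℕ} (hi : 1 ≤ i) (hin : i ≤ n) {u w : K.V}
    (p : K.Path (barWord n i) u w) :
    (K.h i w : ℤ) - K.t i w = (K.h i u : ℤ) - K.t i u - 2 := by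
  have hself : ∀ {a b : K.V}, K.Edge i a b →
      (K.h i b : ℤ) - K.t i b = (K.h i a : ℤ) - K.t i a - 2 := fun {a b} e => by
    have h1 := (H.pathColor i).h_edge e
    have h2 := (H.pathColor i).t_edge e
    omega
  unfold barWord at p
  split_ifs at p with h
  · subst h
    have hnext : ∀ {a b : K.V}, K.Edge (i + 1) a b →
        (K.h i b : ℤ) - K.t i b = (K.h i a : ℤ) - K.t i a + 1 := fun {a b} e => by
      have h3 := ((H.crystal.2.2.1 (i + 1) (Set.mem_Icc.mpr (by omega)) i
        (Set.mem_Icc.mpr (by omega)) (by omega)).1 a b e).2.2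
      rw [if_pos (show Neighb (i + 1) i from Or.inr rfl)] at h3
      omega
    simp only [PreGraph.path_cons, PreGraph.path_nil] at p
    obtain ⟨a, ha, b, hb, c, hc, _, hd, rfl⟩ := p
    have h1 := hself ha
    have h2 := hnext hb
    have h3 := hnext hc
    have h4 := hself hd
    omega
  · obtain ⟨x, hx, hxw⟩ := PreGraph.path_cons.mp p
    rw [PreGraph.path_singleton] at hxw
    have hlow : 1 ≤ i ∧ i < n := by omega
    have h1 := hself hx
    rw [← PreGraph.h_eq_of_squares (H.squares_low_high hlow hlow) hxw,
      ← PreGraph.t_eq_of_squares (H.squares_low_high hlow hlow) hxw]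
    exact h1

theorem extract_pathColor (H : SymCrystal n K σ) {i : ℕ} (hi : 1 ≤ i) (hin : i ≤ n) :
    PathColor (extractC K n σ) i where
  finite := by
    have := H.crystal.1.1
    exact inferInstanceAs (Finite {v // σ v = v})
  inj := fun e e' => Subtype.ext (PreGraph.Path.injective (fun j _ => H.pathColor j)
    ((extractC_edge hi hin).mp e) ((extractC_edge hi hin).mp e'))
  acyclic := fun v k hk p => by
    have hweight : ∀ (m : ℕ) (u w : (extractC K n σ).V),
        (extractC K n σ).Path (List.replicate m i) u w →
        (K.h i w.1 : ℤ) - K.t i w.1 = (K.h i u.1 : ℤ) - K.t i u.1 - 2 * m := by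
      intro m
      induction m with
      | zero =>
        intro u w p
        rw [List.replicate_zero, PreGraph.path_nil] at p
        rw [p]
        simp
      | succ m ih =>
        intro u w p
        rw [List.replicate_succ, PreGraph.path_cons] at p
        obtain ⟨x, hx, hxw⟩ := p
        have h1 := H.weight_barWord hi hin ((extractC_edge hi hin).mp hx)
        have h2 := ih x w hxw
        push_cast
        omega
    have := hweight k v v p
    omega

/-- A path of low colors starting at a fixed vertex lifts to the extract. -/
theorem exists_extract_path_from (H : SymCrystal n K σ) {L : List ℕ}
    (hL : ∀ i ∈ L, 1 ≤ i ∧ i < n) (u : (extractC K n σ).V) {a : K.V} (p : K.Path L u.1 a) :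
    ∃ z : (extractC K n σ).V, (extractC K n σ).Path L u z ∧
      K.Path (L.map (2 * n + 1 - ·)) a z.1 := by
  induction L generalizing u a with
  | nil =>
    rw [PreGraph.path_nil] at p
    exact ⟨u, by simp, by simp [p]⟩
  | cons i L ih =>
    have hi := hL i List.mem_cons_self
    have hL' : ∀ j ∈ L, 1 ≤ j ∧ j < n := fun j hj => hL j (List.mem_cons_of_mem _ hj)
    obtain ⟨x, hx, hxa⟩ := PreGraph.path_cons.mp p
    obtain ⟨v, hv, hxv⟩ := H.exists_bar_from hi u.2 hx
    obtain ⟨y, hy, hvy⟩ := (H.squares_word_edge hL' hi).1 _ _ _ hxa hxv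
    obtain ⟨z, hz, hyz⟩ := ih hL' ⟨v, hv⟩ hvy
    refine ⟨z, PreGraph.path_cons.mpr ⟨⟨v, hv⟩, (extractC_edge_low hi).mpr ⟨x, hx, hxv⟩, hz⟩, ?_⟩
    rw [List.map_cons, PreGraph.path_cons]
    exact ⟨y, hy, hyz⟩

theorem exists_extract_path_to (H : SymCrystal n K σ) {L : List ℕ}
    (hL : ∀ i ∈ L, 1 ≤ i ∧ i < n) (v : (extractC K n σ).V) {a : K.V} (p : K.Path L a v.1) :
    ∃ z : (extractC K n σ).V, (extractC K n σ).Path L z v ∧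
      K.Path (L.map (2 * n + 1 - ·)) z.1 a := by
  induction L using List.reverseRecOn generalizing v a with
  | nil =>
    rw [PreGraph.path_nil] at p
    exact ⟨v, by simp, by simp [p]⟩
  | append_singleton L i ih =>
    have hi := hL i (by simp)
    have hL' : ∀ j ∈ L, 1 ≤ j ∧ j < n := fun j hj => hL j (List.mem_append_left _ hj)
    obtain ⟨x, hax, hx⟩ := PreGraph.path_append.mp p
    rw [PreGraph.path_singleton] at hx
    obtain ⟨u, hu, hux, hux', hxv⟩ := H.exists_bar_to hi v.2 hx
    obtain ⟨y, hy, hyu⟩ := (H.squares_word_edge hL' hi).2.1 _ _ _ hax hux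
    obtain ⟨z, hz, hzy⟩ := ih hL' ⟨u, hu⟩ hyu
    refine ⟨z, PreGraph.path_append.mpr ⟨⟨u, hu⟩, hz, PreGraph.path_singleton.mpr
      ((extractC_edge_low hi).mpr ⟨_, hux', hxv⟩)⟩, ?_⟩
    rw [List.map_append, PreGraph.path_append]
    exact ⟨y, hzy, PreGraph.path_singleton.mpr hy⟩

theorem exists_path_from_of_extract (H : SymCrystal n K σ) {L : List ℕ}
    (hL : ∀ i ∈ L, 1 ≤ i ∧ i < n) {u w : (extractC K n σ).V}
    (p : (extractC K n σ).Path L u w) : ∃ a, K.Path L u.1 a := by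
  induction L generalizing u with
  | nil => exact ⟨u.1, by simp⟩
  | cons i L ih =>
    have hi := hL i List.mem_cons_self
    have hL' : ∀ j ∈ L, 1 ≤ j ∧ j < n := fun j hj => hL j (List.mem_cons_of_mem _ hj)
    obtain ⟨v, huv, hvw⟩ := PreGraph.path_cons.mp p
    obtain ⟨x, hx, hxv⟩ := (extractC_edge_low hi).mp huv
    obtain ⟨a, ha⟩ := ih hL' hvw
    obtain ⟨b, hb, -⟩ := (H.squares_word_edge hL' hi).2.2.1 _ _ _ hxv ha
    exact ⟨b, PreGraph.path_cons.mpr ⟨x, hx, hb⟩⟩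

theorem exists_path_to_of_extract (H : SymCrystal n K σ) {L : List ℕ}
    (hL : ∀ i ∈ L, 1 ≤ i ∧ i < n) {u w : (extractC K n σ).V}
    (p : (extractC K n σ).Path L u w) : ∃ a, K.Path L a w.1 := by
  induction L using List.reverseRecOn generalizing w with
  | nil => exact ⟨w.1, by simp⟩
  | append_singleton L i ih =>
    have hi := hL i (by simp)
    have hL' : ∀ j ∈ L, 1 ≤ j ∧ j < n := fun j hj => hL j (List.mem_append_left _ hj)
    obtain ⟨v, huv, hvw⟩ := PreGraph.path_append.mp p
    obtain ⟨x, hx, hxw⟩ := H.bar_swap hi (PreGraph.path_singleton.mp hvw)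
    obtain ⟨a, ha⟩ := ih hL' huv
    obtain ⟨b, -, hb⟩ := (H.squares_word_edge hL' hi).2.2.2 _ _ _ ha hx
    exact ⟨b, PreGraph.path_append.mpr ⟨x, hb, PreGraph.path_singleton.mpr hxw⟩⟩

theorem extract_h (H : SymCrystal n K σ) {i : ℕ} (hi : 1 ≤ i ∧ i < n)
    (u : (extractC K n σ).V) : (extractC K n σ).h i u = K.h i u.1 := by
  refine PreGraph.h_congr fun k => ?_
  have hL : ∀ j ∈ List.replicate k i, 1 ≤ j ∧ j < n := fun j hj => by
    rwa [List.eq_of_mem_replicate hj]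
  constructor
  · rintro ⟨w, hw⟩
    exact H.exists_path_from_of_extract hL hw
  · rintro ⟨w, hw⟩
    obtain ⟨z, hz, -⟩ := H.exists_extract_path_from hL u hw
    exact ⟨z, hz⟩

theorem extract_t (H : SymCrystal n K σ) {i : ℕ} (hi : 1 ≤ i ∧ i < n)
    (u : (extractC K n σ).V) : (extractC K n σ).t i u = K.t i u.1 := by
  refine PreGraph.t_congr fun k => ?_
  have hL : ∀ j ∈ List.replicate k i, 1 ≤ j ∧ j < n := fun j hj => by
    rwa [List.eq_of_mem_replicate hj]
  constructor
  · rintro ⟨w, hw⟩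
    exact H.exists_path_to_of_extract hL hw
  · rintro ⟨w, hw⟩
    obtain ⟨z, hz, -⟩ := H.exists_extract_path_to hL u hw
    exact ⟨z, hz⟩

/-- Coterminal paths of low colors starting at a fixed vertex lift to coterminal paths of the
extract. -/
theorem exists_extract_common_target (H : SymCrystal n K σ) {L M : List ℕ}
    (hL : ∀ i ∈ L, 1 ≤ i ∧ i < n) (hM : ∀ i ∈ M, 1 ≤ i ∧ i < n) (u : (extractC K n σ).V)
    {w : K.V} (p : K.Path L u.1 w) (q : K.Path M u.1 w) :
    ∃ z, (extractC K n σ).Path L u z ∧ (extractC K n σ).Path M u z := by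
  obtain ⟨z₁, hz₁, hw₁⟩ := H.exists_extract_path_from hL u p
  obtain ⟨z₂, hz₂, hw₂⟩ := H.exists_extract_path_from hM u q
  have p' := H.path_mirror.mpr p
  have q' := H.path_mirror.mpr q
  rw [u.2] at p' q'
  obtain ⟨x, hx, hx'⟩ := (H.squares_words hL hL).1 _ _ _ p p'
  obtain ⟨y, hy, hy'⟩ := (H.squares_words hL hM).1 _ _ _ p q'
  have heq : z₁ = z₂ :=
    Subtype.ext ((hw₁.unique hx).trans ((hx'.unique hy').trans (hy.unique hw₂)))
  exact ⟨z₁, hz₁, heq ▸ hz₂⟩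

theorem exists_extract_common_source (H : SymCrystal n K σ) {L M : List ℕ}
    (hL : ∀ i ∈ L, 1 ≤ i ∧ i < n) (hM : ∀ i ∈ M, 1 ≤ i ∧ i < n) (v : (extractC K n σ).V)
    {w : K.V} (p : K.Path L w v.1) (q : K.Path M w v.1) :
    ∃ z, (extractC K n σ).Path L z v ∧ (extractC K n σ).Path M z v := by
  obtain ⟨z₁, hz₁, hw₁⟩ := H.exists_extract_path_to hL v p
  obtain ⟨z₂, hz₂, hw₂⟩ := H.exists_extract_path_to hM v q
  have p' := H.path_mirror.mpr p
  have q' := H.path_mirror.mpr q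
  rw [v.2] at p' q'
  obtain ⟨x, hx, hx'⟩ := (H.squares_words hL hL).2.1 _ _ _ p p'
  obtain ⟨y, hy, hy'⟩ := (H.squares_words hL hM).2.1 _ _ _ p q'
  have heq : z₁ = z₂ :=
    Subtype.ext ((H.path_injective hw₁ hx).trans
      ((H.path_injective hx' hy').trans (H.path_injective hy hw₂)))
  exact ⟨z₁, hz₁, heq ▸ hz₂⟩

theorem h_high_edge (H : SymCrystal n K σ) {i j : ℕ} (hi : 1 ≤ i ∧ i < n) (hj : 1 ≤ j ∧ j < n)
    {u v : K.V} (e : K.Edge (2 * n + 1 - i) u v) : K.h j u = K.h j v :=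
  PreGraph.h_eq_of_squares (H.squares_low_high hj hi) e

theorem extract_a2at (H : SymCrystal n K σ) {i j : ℕ} (hi : 1 ≤ i ∧ i < n) (hj : 1 ≤ j ∧ j < n)
    (hij : i ≠ j) : A2at (extractC K n σ) i j := by
  obtain ⟨hA, hconvex⟩ := H.crystal.2.2.1 i (Set.mem_Icc.mpr (by omega)) j
    (Set.mem_Icc.mpr (by omega)) hij
  simp only [A2at, PreGraph.f_eq_some_iff, extractC_edge_low hi, H.extract_h hj, H.extract_t hj]
  constructor
  · rintro u v ⟨x, hx, hxv⟩
    rw [← H.h_high_edge hi hj hxv,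
      ← PreGraph.t_eq_of_squares (H.squares_low_high hj hi) hxv]
    exact hA _ _ hx
  · rintro u v w ⟨x, hx, hxv⟩ ⟨y, hy, hyw⟩
    obtain ⟨z, hz, hzy⟩ := (H.squares_low_high hi hi).2.2.1 _ _ _ hxv hy
    rw [← H.h_high_edge hi hj hxv, ← H.h_high_edge hi hj hyw, ← H.h_high_edge hi hj hzy]
    exact hconvex _ _ _ hx hz

theorem extract_a3at (H : SymCrystal n K σ) {i j : ℕ} (hi : 1 ≤ i ∧ i < n) (hj : 1 ≤ j ∧ j < n)
    (hij : Neighb i j) : A3at (extractC K n σ) i j := by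
  obtain ⟨hout, hin⟩ := (H.crystal.2.2.2.1 i (Set.mem_Icc.mpr (by omega)) j
    (Set.mem_Icc.mpr (by omega)) hij).1
  have hL : ∀ k ∈ [i, j], 1 ≤ k ∧ k < n := by simp [hi, hj]
  have hM : ∀ k ∈ [j, i], 1 ≤ k ∧ k < n := by simp [hi, hj]
  simp only [A3at, PreGraph.f_eq_some_iff, H.extract_h hi, H.extract_h hj]
  constructor
  · intro u v v' e e' hl
    obtain ⟨x, hx, hxv⟩ := (extractC_edge_low hi).mp e
    obtain ⟨y, hy, hyv⟩ := (extractC_edge_low hj).mp e'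
    rw [← H.h_high_edge hi hj hxv] at hl
    rw [← H.h_high_edge hj hi hyv]
    obtain ⟨hl', w, hw, hw'⟩ := hout _ _ _ hx hy hl
    refine ⟨hl', ?_⟩
    obtain ⟨z, hz, hz'⟩ := H.exists_extract_common_target hL hM u (w := w)
      (PreGraph.path_cons.mpr ⟨x, hx, PreGraph.path_singleton.mpr hw⟩)
      (PreGraph.path_cons.mpr ⟨y, hy, PreGraph.path_singleton.mpr hw'⟩)
    obtain ⟨a, ha, haz⟩ := PreGraph.path_cons.mp hz
    obtain ⟨b, hb, hbz⟩ := PreGraph.path_cons.mp hz'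
    rw [← e.unique ha] at haz
    rw [← e'.unique hb] at hbz
    exact ⟨z, PreGraph.path_singleton.mp haz, PreGraph.path_singleton.mp hbz⟩
  · intro u u' v e e' hl
    obtain ⟨x, hx, hxv⟩ := H.bar_swap hi e
    obtain ⟨y, hy, hyv⟩ := H.bar_swap hj e'
    rw [H.h_high_edge hi hj hx] at hl
    rw [H.h_high_edge hj hi hy]
    obtain ⟨hl', w, hw, hw'⟩ := hin _ _ _ hxv hyv hl
    refine ⟨hl', ?_⟩
    obtain ⟨z, hz, hz'⟩ := H.exists_extract_common_source hL hM v (w := w)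
      (PreGraph.path_cons.mpr ⟨y, hw', PreGraph.path_singleton.mpr hyv⟩)
      (PreGraph.path_cons.mpr ⟨x, hw, PreGraph.path_singleton.mpr hxv⟩)
    obtain ⟨a, ha, haz⟩ := PreGraph.path_cons.mp hz
    obtain ⟨b, hb, hbz⟩ := PreGraph.path_cons.mp hz'
    rw [(H.extract_pathColor hj.1 hj.2.le).inj (PreGraph.path_singleton.mp haz) e'] at ha
    rw [(H.extract_pathColor hi.1 hi.2.le).inj (PreGraph.path_singleton.mp hbz) e] at hb
    exact ⟨z, hb, ha⟩

theorem extract_a4at (H : SymCrystal n K σ) {i j : ℕ} (hi : 1 ≤ i ∧ i < n) (hj : 1 ≤ j ∧ j < n)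
    (hij : Neighb i j) : A4at (extractC K n σ) i j := by
  obtain ⟨hout, hin⟩ := (a4at_iff_path (H.pathColor i) (H.pathColor j)).mp
    (H.crystal.2.2.2.1 i (Set.mem_Icc.mpr (by omega)) j (Set.mem_Icc.mpr (by omega)) hij).2
  have hL : ∀ k ∈ [i, j, j, i], 1 ≤ k ∧ k < n := by simp [hi, hj]
  have hM : ∀ k ∈ [j, i, i, j], 1 ≤ k ∧ k < n := by simp [hi, hj]
  rw [a4at_iff_path (H.extract_pathColor hi.1 hi.2.le) (H.extract_pathColor hj.1 hj.2.le)]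
  simp only [H.extract_h hi, H.extract_h hj]
  constructor
  · intro u v v' e e' hl hl'
    obtain ⟨x, hx, hxv⟩ := (extractC_edge_low hi).mp e
    obtain ⟨y, hy, hyv⟩ := (extractC_edge_low hj).mp e'
    rw [← H.h_high_edge hi hj hxv] at hl
    rw [← H.h_high_edge hj hi hyv] at hl'
    obtain ⟨w, hw, hw'⟩ := hout _ _ _ hx hy hl hl'
    exact H.exists_extract_common_target hL hM u hw hw'
  · intro u u' v e e' hl hl'
    obtain ⟨x, hx, hxv⟩ := H.bar_swap hi e
    obtain ⟨y, hy, hyv⟩ := H.bar_swap hj e'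
    rw [H.h_high_edge hi hj hx] at hl
    rw [H.h_high_edge hj hi hy] at hl'
    obtain ⟨w, hw, hw'⟩ := hin _ _ _ hxv hyv hl hl'
    exact H.exists_extract_common_source hL hM v hw hw'

end SymCrystal

/-- basic properties of the symmetric extract `C` from a symmetric
`A_{2n}`-crystal: (a) each color class satisfies (A1); (b) for colors at distance `≥ 2`
the operators commute and components are Cartesian products of two monochromatic paths;
(c) for neighboring colors `ibar, jbar` with `i, j < n`, components are `A_2`-crystals. -/
theorem A2n_extract_basic
    (n : ℕ) (hn : 2 ≤ n) (K : PreGraph) (hK : IsACrystal (2 * n) K)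
    (s : K.V) (hs : IsSource K s)
    (c : ℕ → ℕ) (hc : ∀ i, 1 ≤ i → i ≤ 2 * n → K.h i s = c i)
    (hsym : ∀ i, 1 ≤ i → i ≤ 2 * n → c i = c (2 * n + 1 - i))
    (σ : K.V → K.V) (hσb : Function.Bijective σ)
    (hσ : ∀ (i : ℕ) (u v : K.V),
      K.F i u = some v ↔ K.F (2 * n + 1 - i) (σ u) = some (σ v)) :
    (∀ i, 1 ≤ i → i ≤ n →
      (∀ u u' w : (extractC K n σ).V,
        (extractC K n σ).F i u = some w → (extractC K n σ).F i u' = some w → u = u') ∧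
      (∀ (u : (extractC K n σ).V) (k : ℕ), 0 < k →
        optIter ((extractC K n σ).F i) k u ≠ some u)) ∧
    (∀ i j, 1 ≤ i → i ≤ n → 1 ≤ j → j ≤ n → Far i j →
      A5at (extractC K n σ) i j ∧
      (∀ v : (extractC K n σ).V, ∃ p q : ℕ,
        IsoVia ((extractC K n σ).sub {i, j} v) (boxGraph i j p q) (fun x => x))) ∧
    (∀ i j, 1 ≤ i → i < n → 1 ≤ j → j < n → Neighb i j →
      ∀ v : (extractC K n σ).V,
        IsCrystalOn ((extractC K n σ).sub {i, j} v) {i, j}) := by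
  have H : SymCrystal n K σ := ⟨hK, hσb, hσ⟩
  refine ⟨fun i hi hin => ⟨?_, ?_⟩, fun i j hi hin hj hjn hij => ?_,
    fun i j hi hin hj hjn hij v => ?_⟩
  · exact fun u u' w e e' => (H.extract_pathColor hi hin).inj e e'
  · exact fun u k hk p => (H.extract_pathColor hi hin).acyclic u k hk
      (PreGraph.optIter_eq_some_iff.mp p)
  · have hsq := H.extract_squares hi hin hj hjn hij
    have hci := H.extract_pathColor hi hin
    have hcj := H.extract_pathColor hj hjn
    exact ⟨(a5at_iff_squares hci hcj).mpr hsq, fun v => ⟨_, _, hsq.sub_isoVia_boxGraph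
      (by unfold Far at hij; omega) hci hcj v⟩⟩
  · have hne : i ≠ j := by unfold Neighb at hij; omega
    have hji : Neighb j i := Or.symm hij
    have hi' : 1 ≤ i ∧ i < n := ⟨hi, hin⟩
    have hj' : 1 ≤ j ∧ j < n := ⟨hj, hjn⟩
    exact isCrystalOn_sub_pair hij (H.extract_pathColor hi hin.le) (H.extract_pathColor hj hjn.le)
      ⟨H.extract_a2at hi' hj' hne, H.extract_a2at hj' hi' hne.symm⟩
      ⟨H.extract_a3at hi' hj' hij, H.extract_a3at hj' hi' hji⟩
      ⟨H.extract_a4at hi' hj' hij, H.extract_a4at hj' hi' hji⟩ v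
end
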